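/- arXiv:1904.12173 — 6 statements merged into one kernel-verified Lean document; each statement's English description precedes it below -/
import Mathlib

section
/- Let n be an odd prime and let A be the (n-1)×(n-1) matrix with rational entries A_{ij} = ⟨ij/n⟩ (the fractional part of ij/n) for 1 ≤ i, j ≤ n-1. Then for a vector x ∈ ℚ^{n-1}, the vector Ax has all of its coordinates equal if and only if x_k = x_{n-k} for every k with 1 ≤ k ≤ n-1. -/
open Complex HurwitzZeta Filter Topology

lemma aux_parts (w : ℂ) (c : ℕ → ℂ) (h : Summable fun n => w^(n+1) * c n) :
    (1 - w) * ∑' n, w^(n+1) * c n = w * c 0 + ∑' n, w^(n+2) * (c (n+1) - c n) := by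
  have h1 : Summable fun n => w^(n+2) * c (n+1) := by
    simpa [add_assoc] using (summable_nat_add_iff 1).2 h
  have h2 : Summable fun n => w^(n+2) * c n := by
    refine (h.mul_left w).congr fun n => by ring
  have e : ∑' n, w^(n+2) * (c (n+1) - c n) = ∑' n, w^(n+2) * c (n+1) - ∑' n, w^(n+2) * c n := by
    rw [← h1.tsum_sub h2]; congr 1; ext n; ring
  have e2 : ∑' n, w^(n+2) * c n = w * ∑' n, w^(n+1) * c n := by
    rw [← tsum_mul_left]; congr 1; ext n; ring
  have e3 := h.tsum_eq_zero_add
  simp only [zero_add, pow_one] at e3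
  rw [e, e2, sub_mul, one_mul, ← add_sub_assoc]
  congr 1

noncomputable def cc (s : ℝ) (n : ℕ) : ℝ := ((n:ℝ)+1)^(-s)

lemma cc_bound (s : ℝ) (h1 : 1 ≤ s) (h2 : s ≤ 2) (n : ℕ) :
    |cc s (n+1) - cc s n| ≤ 2 * (1 / ((n:ℝ)+1)^2) := by
  have hp : (0:ℝ) < n + 1 := by positivity
  have hle : cc s (n+1) ≤ cc s n := by
    unfold cc
    apply Real.rpow_le_rpow_of_nonpos hp (by push_cast; linarith) (by linarith)
  rw [abs_sub_comm, abs_of_nonneg (by linarith)]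
  have e : cc s (n+1) = cc s n * (((n:ℝ)+1)/((n:ℝ)+2))^s := by
    unfold cc
    rw [Real.div_rpow hp.le (by positivity), Real.rpow_neg hp.le, Real.rpow_neg (by positivity)]
    have : ((n:ℝ)+1)^s ≠ 0 := by positivity
    push_cast
    rw [show (n:ℝ)+1+1 = n+2 by ring]
    field_simp
  have hc : cc s n ≤ 1/((n:ℝ)+1) := by
    unfold cc
    rw [one_div, ← Real.rpow_neg_one]
    exact Real.rpow_le_rpow_of_exponent_le (by linarith [Nat.cast_nonneg (α := ℝ) n]) (by linarith)
  have hc0 : 0 ≤ cc s n := by unfold cc; positivity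
  have hq : (((n:ℝ)+1)/((n:ℝ)+2))^2 ≤ (((n:ℝ)+1)/((n:ℝ)+2))^s := by
    rw [← Real.rpow_two]
    exact Real.rpow_le_rpow_of_exponent_ge (by positivity) (by rw [div_le_one (by positivity)]; linarith) h2
  have hq2 : 1 - (((n:ℝ)+1)/((n:ℝ)+2))^s ≤ 2/((n:ℝ)+1) := by
    refine (sub_le_sub_left hq 1).trans ?_
    rw [div_pow, sub_le_iff_le_add, div_add_div _ _ (by positivity) (by positivity), le_div_iff₀ (by positivity)]
    nlinarith [Nat.cast_nonneg (α := ℝ) n, mul_nonneg (Nat.cast_nonneg (α := ℝ) n) (Nat.cast_nonneg (α := ℝ) n)]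
  rw [e]
  calc cc s n - cc s n * (((n:ℝ)+1)/((n:ℝ)+2))^s = cc s n * (1 - (((n:ℝ)+1)/((n:ℝ)+2))^s) := by ring
    _ ≤ cc s n * (2/((n:ℝ)+1)) := by gcongr
    _ ≤ 1/((n:ℝ)+1) * (2/((n:ℝ)+1)) := by gcongr
    _ = _ := by field_simp

lemma cc_cont (n : ℕ) : Continuous fun s => cc s n := by
  unfold cc
  have : (n:ℝ)+1 ≠ 0 := by positivity
  fun_prop (disch := assumption)

lemma sq_summable : Summable fun n : ℕ => 2 * (1 / ((n:ℝ)+1)^2) := by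
  apply Summable.mul_left
  have := (summable_nat_add_iff 1).2 (Real.summable_one_div_nat_pow.2 (one_lt_two))
  simpa using this

lemma H_tendsto {l : Filter ℝ} (w : ℝ → ℂ) (s : ℝ → ℝ) (w₀ : ℂ) (s₀ : ℝ)
    (hw : Tendsto w l (𝓝 w₀)) (hs : Tendsto s l (𝓝 s₀))
    (hb : ∀ᶠ t in l, ‖w t‖ ≤ 1 ∧ 1 ≤ s t ∧ s t ≤ 2) :
    Tendsto (fun t => ∑' n, w t ^(n+2) * ((cc (s t) (n+1) : ℂ) - cc (s t) n)) l
      (𝓝 (∑' n, w₀^(n+2) * ((cc s₀ (n+1) : ℂ) - cc s₀ n))) := by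
  refine tendsto_tsum_of_dominated_convergence sq_summable (fun n => ?_) ?_
  · refine (hw.pow _).mul (Tendsto.sub ?_ ?_)
    · exact ((continuous_ofReal.comp (cc_cont (n+1))).tendsto s₀).comp hs
    · exact ((continuous_ofReal.comp (cc_cont n)).tendsto s₀).comp hs
  · filter_upwards [hb] with t ht n
    rw [norm_mul, norm_pow, ← ofReal_sub, norm_real, Real.norm_eq_abs]
    exact (mul_le_of_le_one_left (abs_nonneg _) (pow_le_one₀ (norm_nonneg _) ht.1)).trans
      (cc_bound _ ht.2.1 ht.2.2 n)

lemma expZeta_one (x : ℝ) (hx : (x : UnitAddCircle) ≠ 0) :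
    expZeta x 1 = -log (1 - cexp (2 * Real.pi * I * x)) := by
  set z := cexp (2 * Real.pi * I * x) with hz
  have hzn : ‖z‖ = 1 := by
    rw [hz, show 2 * (Real.pi:ℂ) * I * x = ((2 * Real.pi * x : ℝ) : ℂ) * I by push_cast; ring]
    exact norm_exp_ofReal_mul_I _
  have hz1 : z ≠ 1 := by
    intro h
    rw [hz, exp_eq_one_iff] at h
    obtain ⟨k, hk⟩ := h
    apply hx
    have : (x:ℂ) = k := by
      have := Real.pi_ne_zero
      have h2 : (2 * (Real.pi:ℂ) * I) ≠ 0 := by simp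
      apply mul_left_cancel₀ h2
      rw [hk]; ring
    have : x = k := by exact_mod_cast this
    rw [this, AddCircle.coe_eq_zero_iff]
    exact ⟨k, by simp⟩
  have hslit : 1 - z ∈ slitPlane := by
    left
    have h1 : z.re ≤ 1 := hzn ▸ re_le_norm z
    have h2 : z.re ≠ 1 := by
      intro h
      apply hz1
      have h3 := Complex.sq_norm z
      rw [hzn, normSq_apply, h] at h3
      have : z.im = 0 := by nlinarith
      apply Complex.ext <;> simp [h, this]
    have := lt_of_le_of_ne h1 h2
    simpa using this
  set L := z + ∑' n, z^(n+2) * ((cc 1 (n+1) : ℂ) - cc 1 n) with hL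
  -- limit in s
  have A : (1 - z) * expZeta x 1 = L := by
    have t1 : Tendsto (fun s : ℝ => (1 - z) * expZeta x s) (𝓝[>] 1) (𝓝 ((1 - z) * expZeta x 1)) := by
      refine Tendsto.const_mul _ ?_
      have := ((differentiable_expZeta_of_ne_zero hx).continuous.comp continuous_ofReal).tendsto (1:ℝ)
      simp only [Function.comp_def, ofReal_one] at this
      exact this.mono_left nhdsWithin_le_nhds
    have t2 : Tendsto (fun s : ℝ => z + ∑' n, z^(n+2) * ((cc s (n+1) : ℂ) - cc s n)) (𝓝[>] 1) (𝓝 L) := by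
      refine tendsto_const_nhds.add (H_tendsto (fun _ => z) (fun s => s) z 1 tendsto_const_nhds
        (tendsto_id.mono_left nhdsWithin_le_nhds) ?_)
      filter_upwards [Ioc_mem_nhdsGT (show (1:ℝ) < 2 by norm_num)] with s hs
      exact ⟨hzn.le, hs.1.le, hs.2⟩
    refine tendsto_nhds_unique t1 (t2.congr' ?_)
    filter_upwards [self_mem_nhdsWithin] with s hs
    have hs : 1 < s := hs
    have hsum := hasSum_expZeta_of_one_lt_re x (s := s) (by simpa using hs)
    have hs0 : (s:ℂ) ≠ 0 := by
      have : s ≠ 0 := by linarith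
      exact_mod_cast this
    have hsum' : HasSum (fun n : ℕ => z^(n+1) * (cc s n : ℂ)) (expZeta x s) := by
      have := (hasSum_nat_add_iff' 1).2 hsum
      simp only [Finset.range_one, Finset.sum_singleton, Nat.cast_zero, zero_cpow hs0, div_zero, sub_zero] at this
      refine this.congr_fun ?_ |> fun h => h
      intro n
      rw [hz, ← Complex.exp_nat_mul, cc, ofReal_cpow (by positivity)]
      push_cast
      rw [cpow_neg, div_eq_mul_inv]
      congr 2
      ring
    have := aux_parts z (fun n => (cc s n : ℂ)) hsum'.summable
    rw [hsum'.tsum_eq] at this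
    rw [this]
    simp [cc]
  have B : (1 - z) * (-log (1 - z)) = L := by
    have tw : Tendsto (fun r : ℝ => (r:ℂ) * z) (𝓝[<] 1) (𝓝 z) := by
      have : Continuous (fun r : ℝ => (r:ℂ) * z) := by fun_prop
      simpa using (this.tendsto 1).mono_left nhdsWithin_le_nhds
    have t1 : Tendsto (fun r : ℝ => (1 - r * z) * (-log (1 - r * z))) (𝓝[<] 1) (𝓝 ((1 - z) * (-log (1 - z)))) := by
      have h1 := tendsto_const_nhds (x := (1:ℂ)) |>.sub tw
      exact h1.mul (h1.clog hslit).neg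
    have hev : ∀ᶠ r : ℝ in 𝓝[<] 1, ‖(r:ℂ) * z‖ < 1 := by
      filter_upwards [Ioo_mem_nhdsLT (show (0:ℝ) < 1 by norm_num)] with r hr
      rw [norm_mul, hzn, mul_one, norm_real, Real.norm_eq_abs, abs_of_pos hr.1]
      exact hr.2
    have t2 : Tendsto (fun r : ℝ => r * z + ∑' n, (r * z)^(n+2) * ((cc 1 (n+1) : ℂ) - cc 1 n)) (𝓝[<] 1) (𝓝 L) := by
      refine tw.add (H_tendsto (fun r => r * z) (fun _ => 1) z 1 tw tendsto_const_nhds ?_)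
      filter_upwards [hev] with r hr
      exact ⟨hr.le, le_refl _, by norm_num⟩
    refine tendsto_nhds_unique t1 (t2.congr' ?_)
    filter_upwards [hev] with r hr
    have hsum := hasSum_taylorSeries_neg_log' hr
    have hsum' : HasSum (fun n : ℕ => ((r:ℂ)*z)^(n+1) * (cc 1 n : ℂ)) (-log (1 - r * z)) := by
      refine hsum.congr_fun ?_ |> fun h => h
      intro n
      simp [cc, Real.rpow_neg_one, div_eq_mul_inv]
    have := aux_parts (r*z) (fun n => (cc 1 n : ℂ)) hsum'.summable
    rw [hsum'.tsum_eq] at this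
    rw [this]
    simp [cc]
  exact mul_left_cancel₀ (sub_ne_zero.2 hz1.symm) (A.trans B.symm)

lemma arg_aux (x : ℝ) (h0 : 0 < x) (h1 : x < 1) :
    log (1 - cexp (2 * Real.pi * I * x)) - log (1 - cexp (2 * Real.pi * I * (-x : ℝ))) =
      2 * I * (Real.pi * (x - 1/2)) := by
  have key : ∀ y : ℝ, 1 - cexp (2 * Real.pi * I * y) = (2 * Real.sin (Real.pi * y) : ℝ) *
      (cos (Real.pi * (y - 1/2) : ℝ) + sin (Real.pi * (y - 1/2) : ℝ) * I) := by
    intro y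
    rw [show 2 * (Real.pi:ℂ) * I * y = (2 * (Real.pi * y)) * I by ring, exp_mul_I, cos_two_mul, sin_two_mul]
    push_cast
    rw [show (Real.pi : ℂ) * (y - 1/2) = Real.pi * y - Real.pi / 2 by ring, Complex.cos_sub_pi_div_two, Complex.sin_sub_pi_div_two]
    have := Complex.sin_sq_add_cos_sq (Real.pi * y)
    linear_combination (-2) * this
  have hpi := Real.pi_pos
  have hs : 0 < Real.sin (Real.pi * x) := Real.sin_pos_of_pos_of_lt_pi (by positivity) (by nlinarith)
  have a1 : arg (1 - cexp (2 * Real.pi * I * x)) = Real.pi * (x - 1/2) := by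
    rw [key, arg_mul_cos_add_sin_mul_I (by positivity)]
    constructor <;> nlinarith
  have hconj : 1 - cexp (2 * Real.pi * I * (-x : ℝ)) = (starRingEnd ℂ) (1 - cexp (2 * Real.pi * I * x)) := by
    rw [map_sub, map_one, ← exp_conj]
    have h2 : (starRingEnd ℂ) 2 = 2 := Complex.conj_ofNat 2
    simp [h2]
  have hne : arg (1 - cexp (2 * Real.pi * I * x)) ≠ Real.pi := by
    rw [a1]; nlinarith
  rw [hconj, log_conj _ hne, Complex.sub_conj, log_im, a1]
  push_cast
  ring

lemma hurwitz_zero (x : ℝ) (h0 : 0 < x) (h1 : x < 1) : hurwitzZeta (x : UnitAddCircle) 0 = 1/2 - x := by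
  have hx : (x : UnitAddCircle) ≠ 0 := by
    intro h
    rw [AddCircle.coe_eq_zero_iff] at h
    obtain ⟨k, hk⟩ := h
    simp only [zsmul_eq_mul, mul_one] at hk
    rw [← hk] at h0 h1
    have h0 : 0 < k := by exact_mod_cast h0
    have h1 : k < 1 := by exact_mod_cast h1
    omega
  have hx' : ((-x : ℝ) : UnitAddCircle) ≠ 0 := by simpa using hx
  have := hurwitzZeta_one_sub (x : UnitAddCircle) (s := 1) (fun n h => by
    have := congrArg re h
    simp at this
    linarith [Nat.cast_nonneg (α := ℝ) n]) (Or.inl hx)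
  rw [sub_self] at this
  have e1 := expZeta_one x hx
  have e2 := expZeta_one (-x) hx'
  have e3 := arg_aux x h0 h1
  rw [show ((-x : ℝ) : UnitAddCircle) = -(x:UnitAddCircle) by simp] at e2
  rw [this, e1, e2]
  have f1 : cexp (Real.pi * I * 1 / 2) = I := by
    rw [show Real.pi * I * 1 / 2 = (Real.pi:ℂ)/2 * I by ring, exp_pi_div_two_mul_I]
  have f2 : cexp (-Real.pi * I * 1 / 2) = -I := by
    rw [show -Real.pi * I * 1 / 2 = -(Real.pi:ℂ)/2 * I by ring, exp_neg_pi_div_two_mul_I]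
  rw [f1, f2, Complex.Gamma_one, cpow_neg_one]
  have hpi : (Real.pi:ℂ) ≠ 0 := by simp
  calc _ = (2 * (Real.pi:ℂ))⁻¹ * (I * (log (1 - cexp (2 * Real.pi * I * x)) - log (1 - cexp (2 * Real.pi * I * (-x : ℝ))))) := by ring
    _ = (2 * (Real.pi:ℂ))⁻¹ * (2 * (I * I) * (Real.pi * (x - 1/2))) := by rw [e3]; ring
    _ = _ := by rw [I_mul_I]; field_simp; ring

lemma B1_ne_zero (p : ℕ) [hp : Fact p.Prime] (χ : DirichletCharacter ℂ p) (hχ : χ.Odd) :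
    ∑ k : ZMod p, χ k * ((k.val : ℂ) / p) ≠ 0 := by
  have hp1 : p ≠ 1 := hp.out.one_lt.ne'
  have hne : χ ≠ 1 := by
    rintro rfl
    have h : (1 : DirichletCharacter ℂ p) (-1) = -1 := hχ
    rw [MulChar.one_apply (by simp)] at h
    norm_num at h
  have hne' : χ⁻¹ ≠ 1 := by simpa using hne
  have hprim : χ.IsPrimitive := by
    rcases (Nat.dvd_prime hp.out).1 (χ.conductor_dvd_level) with h | h
    · exact absurd ((DirichletCharacter.eq_one_iff_conductor_eq_one).2 h) hne
    · exact h
  have hL : DirichletCharacter.LFunction χ 0 ≠ 0 := by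
    rw [DirichletCharacter.LFunction_eq_completed_div_gammaFactor χ 0 (Or.inr hp1)]
    have h1 := hprim.completedLFunction_one_sub 1
    rw [sub_self] at h1
    have h2 := DirichletCharacter.LFunction_apply_one_ne_zero hne'
    rw [DirichletCharacter.LFunction_eq_completed_div_gammaFactor χ⁻¹ 1 (Or.inr hp1)] at h2
    have h3 := (div_ne_zero_iff.1 h2).1
    rw [h1, hχ.gammaFactor_def]
    have hpc : (p:ℂ) ≠ 0 := by exact_mod_cast hp.out.ne_zero
    have hg : gaussSum χ ZMod.stdAddChar ≠ 0 :=
      gaussSum_ne_zero_of_nontrivial (by simpa using hpc) hne (ZMod.isPrimitive_stdAddChar p)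
    refine div_ne_zero (mul_ne_zero (mul_ne_zero ?_ ?_) h3) ?_
    · simp [cpow_eq_zero_iff, hpc]
    · unfold DirichletCharacter.rootNumber
      refine div_ne_zero (div_ne_zero hg ?_) ?_
      · exact pow_ne_zero _ I_ne_zero
      · simp [cpow_eq_zero_iff, hpc]
    · exact Gammaℝ_ne_zero_of_re_pos (by simp)
  have hsum : ∑ k, χ k = 0 := χ.sum_eq_zero_of_ne_one hne
  intro h
  apply hL
  rw [DirichletCharacter.LFunction, ZMod.LFunction]
  have : ∀ k : ZMod p, χ k * hurwitzZeta (ZMod.toAddCircle k) 0 = χ k * (1/2) - χ k * ((k.val:ℂ)/p) := by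
    intro k
    by_cases hk : k = 0
    · subst hk
      rw [χ.map_zero' hp1]; simp
    · have hpp : (0:ℝ) < p := by exact_mod_cast hp.out.pos
      have hkv : 0 < k.val := Nat.pos_of_ne_zero (by simpa [ZMod.val_eq_zero] using hk)
      rw [ZMod.toAddCircle_apply, hurwitz_zero]
      · push_cast; ring
      · have : (0:ℝ) < k.val := by exact_mod_cast hkv
        positivity
      · rw [div_lt_one hpp]; exact_mod_cast ZMod.val_lt k
  simp_rw [this]
  rw [Finset.sum_sub_distrib, h, ← Finset.sum_mul, hsum]
  simp

lemma core (p : ℕ) [hp : Fact p.Prime] (y : ZMod p → ℂ) (hodd : ∀ j, y (-j) = - y j)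
    (h0 : y 0 = 0)
    (H : ∀ i : ZMod p, i ≠ 0 → ∑ j, (((i * j).val : ℂ) / p) * y j = 0) : y = 0 := by
  have hp1 : p ≠ 1 := hp.out.one_lt.ne'
  have T : ∀ χ : DirichletCharacter ℂ p, ∑ j, χ j⁻¹ * y j = 0 := by
    intro χ
    rcases χ.even_or_odd with hχ | hχ
    · have : ∑ j, χ j⁻¹ * y j = -∑ j, χ j⁻¹ * y j := by
        rw [← Finset.sum_neg_distrib, ← Equiv.sum_comp (Equiv.neg (ZMod p)) (fun j => χ j⁻¹ * y j)]
        refine Finset.sum_congr rfl fun j _ => ?_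
        rw [Equiv.neg_apply, hodd, inv_neg, hχ.eval_neg]; ring
      exact CharZero.eq_neg_self_iff.1 this
    · have e : ∑ i : ZMod p, χ i * ∑ j, (((i * j).val : ℂ) / p) * y j =
          (∑ k : ZMod p, χ k * ((k.val : ℂ) / p)) * ∑ j, χ j⁻¹ * y j := by
        simp_rw [Finset.mul_sum]
        rw [Finset.sum_comm]
        refine Finset.sum_congr rfl fun j _ => ?_
        by_cases hj : j = 0
        · subst hj; simp [h0]
        · rw [Finset.sum_mul, ← Equiv.sum_comp (Equiv.mulRight₀ j hj)
            (fun k => χ k * ((k.val : ℂ) / p) * (χ j⁻¹ * y j))]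
          refine Finset.sum_congr rfl fun i _ => ?_
          have : χ (i * j) * χ j⁻¹ = χ i := by rw [← map_mul, mul_inv_cancel_right₀ hj]
          simp only [Equiv.mulRight₀_apply]
          rw [← this]; ring
      have z : ∑ i : ZMod p, χ i * ∑ j, (((i * j).val : ℂ) / p) * y j = 0 := by
        refine Finset.sum_eq_zero fun i _ => ?_
        by_cases hi : i = 0
        · subst hi; rw [χ.map_zero' hp1, zero_mul]
        · rw [H i hi, mul_zero]
      rw [e] at z
      exact (mul_eq_zero.1 z).resolve_left (B1_ne_zero p χ hχ)
  ext a
  have e : ∑ χ : DirichletCharacter ℂ p, χ a * ∑ j, χ j⁻¹ * y j = p.totient * y a := by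
    simp_rw [Finset.mul_sum]
    rw [Finset.sum_comm, Finset.sum_eq_single a]
    · by_cases ha : a = 0
      · subst ha; simp [h0]
      · have := DirichletCharacter.sum_char_inv_mul_char_eq ℂ (Ne.isUnit ha) a
        rw [if_pos rfl] at this
        rw [← this, Finset.sum_mul]
        exact Finset.sum_congr rfl fun χ _ => by ring
    · intro j _ hja
      by_cases hj : j = 0
      · subst hj; simp [h0]
      · have := DirichletCharacter.sum_char_inv_mul_char_eq ℂ (Ne.isUnit hj) a
        rw [if_neg hja] at this
        rw [← zero_mul (y j), ← this, Finset.sum_mul]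
        exact Finset.sum_congr rfl fun χ _ => by ring
    · simp
  simp_rw [T, mul_zero, Finset.sum_const_zero] at e
  have : (p.totient : ℂ) ≠ 0 := by
    exact_mod_cast (Nat.totient_pos.2 hp.out.pos).ne'
  exact (mul_eq_zero.1 e.symm).resolve_left this

lemma fin_case (m : ℕ) (hp : (m+1).Prime)
    (A : Matrix (Fin m) (Fin m) ℚ)
    (hA : ∀ i j : Fin m,
      A i j = Int.fract ((((i.val + 1) * (j.val + 1) : ℕ) : ℚ) / ((m + 1 : ℕ) : ℚ)))
    (x : Fin m → ℚ) :
    (∃ c : ℚ, ∀ i : Fin m, A.mulVec x i = c) ↔ (∀ i : Fin m, x i = x i.rev) := by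
  have := Fact.mk hp
  have hval : ∀ i j : Fin m, A i j = ((((i.val + 1) * (j.val + 1)) % (m+1) : ℕ) : ℚ) / ((m + 1 : ℕ) : ℚ) := by
    intro i j
    rw [hA, Int.fract_div_natCast_eq_div_natCast_mod]
  have hrev : ∀ j : Fin m, (j.rev.val + 1 : ℕ) = (m + 1) - (j.val + 1) := by
    intro j; rw [Fin.val_rev]; omega
  have hnd : ∀ i j : Fin m, ¬ (m+1) ∣ (i.val + 1) * (j.val + 1) := by
    intro i j h
    rcases (hp.dvd_mul).1 h with h | h
    · exact absurd (Nat.le_of_dvd (by omega) h) (by omega)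
    · exact absurd (Nat.le_of_dvd (by omega) h) (by omega)
  have hnn : ∀ a b : ℕ, (m+1) ∣ a + b → ¬ (m+1) ∣ a → a % (m+1) + b % (m+1) = m + 1 := by
    intro a b hab ha
    have h1 : 0 < a % (m+1) := Nat.pos_of_ne_zero fun h => ha (Nat.dvd_of_mod_eq_zero h)
    have h2 := Nat.mod_lt a (Nat.succ_pos m)
    have h3 := Nat.mod_lt b (Nat.succ_pos m)
    have h4 : (m+1) ∣ a % (m+1) + b % (m+1) := by
      rw [Nat.dvd_iff_mod_eq_zero] at hab ⊢
      rw [← Nat.add_mod]; exact hab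
    obtain ⟨k, hk⟩ := h4
    have : k = 1 := by
      have k1 : 0 < k := Nat.pos_of_ne_zero (by rintro rfl; omega)
      have k2 : k < 2 := by by_contra hc; push Not at hc; nlinarith
      omega
    subst this; omega
  have hm : ((m+1 : ℕ) : ℚ) ≠ 0 := by positivity
  have hAr : ∀ i j : Fin m, A i j + A i j.rev = 1 := by
    intro i j
    rw [hval, hval, ← add_div, div_eq_one_iff_eq hm]
    norm_cast
    apply hnn _ _ _ (hnd i j)
    rw [← Nat.mul_add, hrev]
    exact Dvd.dvd.mul_left (by rw [show j.val + 1 + (m + 1 - (j.val + 1)) = m + 1 by omega]) _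
  have hsymm : ∀ i j, A i j = A j i := by intro i j; rw [hval, hval, Nat.mul_comm]
  have hAr' : ∀ i j : Fin m, A i.rev j = 1 - A i j := by
    intro i j
    rw [hsymm, hsymm i j, ← hAr j i]; ring
  have hsumrev : ∀ f : Fin m → ℚ, ∑ j : Fin m, f j.rev = ∑ j, f j := fun f => Equiv.sum_comp Fin.revPerm f
  constructor
  · rintro ⟨c, hc⟩
    set y : Fin m → ℚ := fun j => x j - x j.rev with hy
    have hyr : ∀ j, y j.rev = - y j := by intro j; simp [hy]
    have hAy : ∀ i, ∑ j, A i j * y j = 0 := by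
      intro i
      have h1 : ∑ j, A i j * x j = c := hc i
      have h2 : ∑ j, A i.rev j * x j = c := hc i.rev
      have h3 : ∑ j, A i j * x j.rev = ∑ j, A i j.rev * x j := by
        rw [← hsumrev]; simp
      have h4 : ∀ j, A i j.rev = A i.rev j := by
        intro j; rw [hAr', ← hAr i j]; ring
      simp_rw [hy, mul_sub]
      rw [Finset.sum_sub_distrib, h3]
      simp_rw [h4]
      rw [h1, h2, sub_self]
    let Y : ZMod (m+1) → ℂ := fun j => (Fin.cons (0:ℂ) (fun i => ((y i : ℚ) : ℂ)) : Fin (m+1) → ℂ) j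
    have hYs : ∀ i : Fin m, Y (i.succ : Fin (m+1)) = (y i : ℂ) := fun i => rfl
    have hY0 : Y 0 = 0 := rfl
    have hneg : ∀ i : Fin m, (-(i.succ : ZMod (m+1)) : ZMod (m+1)) = (i.rev.succ : Fin (m+1)) := by
      intro i
      rw [neg_eq_iff_add_eq_zero]
      apply Fin.ext
      change ((i.succ : Fin (m+1)) + (i.rev.succ : Fin (m+1))).val = 0
      rw [Fin.val_add, Fin.val_succ, Fin.val_succ, hrev,
        show i.val + 1 + (m + 1 - (i.val + 1)) = m + 1 by omega, Nat.mod_self]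
    have key := core (m+1) Y ?_ hY0 ?_
    · intro i
      have := congrFun key (i.succ : Fin (m+1))
      have this : (y i : ℂ) = 0 := (hYs i).symm.trans this
      have h : y i = 0 := by exact_mod_cast this
      exact sub_eq_zero.1 h
    · intro j
      induction j using Fin.cases with
      | zero =>
        change Y (-0) = - Y 0
        rw [neg_zero, hY0, neg_zero]
      | succ i =>
        refine (congrArg Y (hneg i)).trans ((hYs _).trans ?_)
        rw [hyr]; push_cast; rfl
    · intro i hi
      induction i using Fin.cases with
      | zero => exact absurd rfl hi
      | succ i =>
        have := hAy i
        have e := Fin.sum_univ_succ (n := m) (fun j : Fin (m+1) => ((((i.succ : ZMod (m+1)) * (j : ZMod (m+1))).val : ℂ) / ((m+1 : ℕ) : ℂ)) * Y j)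
        refine e.trans ?_
        have z : Y (0 : Fin (m+1)) = 0 := rfl
        rw [z, mul_zero, zero_add]
        have c : (((∑ j, A i j * y j : ℚ)) : ℂ) = 0 := by rw [this]; simp
        rw [← c, Rat.cast_sum]
        refine Finset.sum_congr rfl fun j _ => ?_
        have hv : ((i.succ : ZMod (m+1)) * (j.succ : Fin (m+1)) : ZMod (m+1)).val =
            ((i.val + 1) * (j.val + 1)) % (m+1) := ZMod.val_mul (n := m+1) i.succ j.succ
        refine (congrArg (fun t : ℕ => ((t:ℂ)/((m+1:ℕ):ℂ)) * (y j:ℂ)) hv).trans ?_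
        rw [hval]
        push_cast
        rfl
  · intro h
    refine ⟨(∑ j, x j) / 2, fun i => ?_⟩
    change ∑ j, A i j * x j = _
    have h1 : ∑ j, A i j * x j = ∑ j, A i j.rev * x j := by
      rw [← hsumrev]
      exact Finset.sum_congr rfl fun j _ => by rw [← h j]
    have h2 : ∑ j, A i j * x j + ∑ j, A i j.rev * x j = ∑ j, x j := by
      rw [← Finset.sum_add_distrib]
      exact Finset.sum_congr rfl fun j _ => by rw [← add_mul, hAr, one_mul]
    linarith

/-- For an odd prime `n`, let `A` be the `(n-1) × (n-1)` matrix over `ℚ` whose `(i,j)` entry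
(for `1 ≤ i, j ≤ n-1`, here indexed by `Fin (n-1)` via `k = i+1`) is the fractional part
`⟨ij/n⟩`. Then for `x ∈ ℚ^{n-1}`, the vector `A x` has all coordinates equal iff
`x_k = x_{n-k}` for all `1 ≤ k ≤ n-1`. -/
theorem stmt_0 (n : ℕ) (hn : n.Prime) (hodd : Odd n)
    (A : Matrix (Fin (n - 1)) (Fin (n - 1)) ℚ)
    (hA : ∀ i j : Fin (n - 1),
      A i j = Int.fract ((((i.val + 1) * (j.val + 1) : ℕ) : ℚ) / (n : ℚ)))
    (x : Fin (n - 1) → ℚ) :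
    (∃ c : ℚ, ∀ i : Fin (n - 1), A.mulVec x i = c) ↔
      (∀ i : Fin (n - 1), x i = x i.rev) := by
  obtain ⟨m, rfl⟩ : ∃ m, n = m + 1 := ⟨n - 1, by have := hn.pos; omega⟩
  exact fin_case m hn A hA x
end

section
/- Fix a finite field 𝔽_q and an integer k ≥ 1. For each integer m ≥ 0, let a_k(m) = ∑_H k^{ω(H)}, the sum over all monic squarefree polynomials H ∈ 𝔽_q[x] of degree m. Then, as m → ∞, the ratio a_k(m)/(q^m · m^{k-1}) tends to φ_k/(k-1)!, where φ_k = ∏_Q (1 + k·|Q|^{-1})·(1 - |Q|^{-1})^k, the product being over all monic irreducible polynomials Q ∈ 𝔽_q[x]. -/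
open Polynomial Filter Topology

set_option linter.unusedSectionVars false
set_option linter.unusedSimpArgs false

namespace S8

section
variable {F : Type*} [Field F] [Fintype F]

open Classical in
/-- Monic polynomials of degree `n`. -/
noncomputable def mon (F : Type*) [Field F] [Fintype F] (n : ℕ) : Finset F[X] :=
  Finset.univ.image (fun c : Fin n → F => X ^ n + ∑ i : Fin n, C (c i) * X ^ (i : ℕ))

lemma deg_lt {n : ℕ} (c : Fin n → F) :
    (∑ i : Fin n, C (c i) * X ^ (i : ℕ) : F[X]).degree < n := by
  rcases Nat.eq_zero_or_pos n with h | h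
  · subst h; simp
  · refine (Polynomial.degree_sum_le _ _).trans_lt ?_
    rw [Finset.sup_lt_iff (by simp [WithBot.bot_lt_coe])]
    intro i _
    exact (degree_C_mul_X_pow_le _ _).trans_lt (by exact_mod_cast i.2)

lemma coeff_c {n : ℕ} (c : Fin n → F) (j : Fin n) :
    (∑ i : Fin n, C (c i) * X ^ (i : ℕ) : F[X]).coeff j = c j := by
  simp [coeff_C_mul, coeff_X_pow, Fin.val_inj]

lemma mem_mon {n : ℕ} {H : F[X]} : H ∈ mon F n ↔ H.Monic ∧ H.natDegree = n := by
  classical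
  unfold mon
  simp only [Finset.mem_image, Finset.mem_univ, true_and]
  constructor
  · rintro ⟨c, rfl⟩
    refine ⟨monic_X_pow_add (deg_lt c), ?_⟩
    apply natDegree_eq_of_degree_eq_some
    rw [degree_add_eq_left_of_degree_lt] <;> rw [degree_X_pow]
    exact deg_lt c
  · rintro ⟨hm, rfl⟩
    refine ⟨fun i => H.coeff i, ?_⟩
    conv_rhs => rw [hm.as_sum]
    rw [Finset.sum_range]

lemma card_mon (n : ℕ) : (mon F n).card = Fintype.card F ^ n := by
  classical
  unfold mon
  rw [Finset.card_image_of_injective]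
  · simp
  · intro c c' h
    have h' := add_left_cancel h
    funext j
    rw [← coeff_c c j, h', coeff_c]

/-- Generating series of a weight on monic polynomials. -/
noncomputable def PS (w : F[X] → ℝ) : PowerSeries ℝ := PowerSeries.mk fun n => ∑ H ∈ mon F n, w H

lemma PS_congr {w w' : F[X] → ℝ} (h : ∀ H : F[X], H.Monic → w H = w' H) : PS w = PS w' := by
  ext n
  simp only [PS, PowerSeries.coeff_mk]
  exact Finset.sum_congr rfl fun H hH => h H (mem_mon.1 hH).1

lemma PS_add (w w' : F[X] → ℝ) : PS (fun H => w H + w' H) = PS w + PS w' := by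
  ext n; simp [PS, Finset.sum_add_distrib]

lemma PS_sub (w w' : F[X] → ℝ) : PS (fun H => w H - w' H) = PS w - PS w' := by
  ext n; simp [PS, Finset.sum_sub_distrib]

open Classical in
lemma PS_shift (w : F[X] → ℝ) {Q : F[X]} (hQ : Q.Monic) :
    PS (fun H => if Q ∣ H then w (H /ₘ Q) else 0) = PowerSeries.X ^ Q.natDegree * PS w := by
  ext n
  rw [PowerSeries.coeff_X_pow_mul']
  simp only [PS, PowerSeries.coeff_mk]
  rw [← Finset.sum_filter]
  split_ifs with h
  · symm
    refine Finset.sum_bij (fun H _ => Q * H) ?_ ?_ ?_ ?_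
    · intro H hH
      rw [mem_mon] at hH
      simp only [Finset.mem_filter, mem_mon, dvd_mul_right, and_true]
      refine ⟨hQ.mul hH.1, ?_⟩
      rw [hQ.natDegree_mul hH.1]; omega
    · intro a _ b _ hab
      exact mul_left_cancel₀ hQ.ne_zero hab
    · intro H hH
      simp only [Finset.mem_filter, mem_mon] at hH
      obtain ⟨⟨hm, hd⟩, H', rfl⟩ := hH
      have hm' : H'.Monic := hQ.of_mul_monic_left hm
      refine ⟨H', ?_, rfl⟩
      rw [mem_mon]
      rw [hQ.natDegree_mul hm'] at hd
      exact ⟨hm', by omega⟩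
    · intro H _
      rw [mul_divByMonic_cancel_left _ hQ]
  · apply Finset.sum_eq_zero
    intro H hH
    simp only [Finset.mem_filter, mem_mon] at hH
    obtain ⟨⟨hm, hd⟩, H', rfl⟩ := hH
    have hm' : H'.Monic := hQ.of_mul_monic_left hm
    rw [hQ.natDegree_mul hm'] at hd
    omega

/-- Type of monic irreducibles. -/
abbrev Pr (F : Type*) [Field F] := {Q : F[X] // Q.Monic ∧ Irreducible Q}

lemma Pr.dvd_iff (Q Q' : Pr F) : Q.1 ∣ Q'.1 ↔ Q = Q' := by
  constructor
  · intro h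
    apply Subtype.ext
    exact eq_of_monic_of_associated Q.2.1 Q'.2.1 (Q.2.2.associated_of_dvd Q'.2.2 h)
  · rintro rfl; exact dvd_rfl

lemma Pr.prime (Q : Pr F) : Prime Q.1 := Q.2.2.prime

lemma Pr.pos (Q : Pr F) : 0 < Q.1.natDegree := Q.2.2.natDegree_pos

/-- No prime of `S` divides `H`. -/
def cop (S : Finset (Pr F)) (H : F[X]) : Prop := ∀ Q ∈ S, ¬ Q.1 ∣ H

open Classical in
lemma cop_insert (S : Finset (Pr F)) (Q : Pr F) (H : F[X]) :
    cop (insert Q S) H ↔ ¬ Q.1 ∣ H ∧ cop S H := by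
  simp [cop]

lemma cop_mul (S : Finset (Pr F)) (Q : Pr F) (hQ : Q ∉ S) (H : F[X]) :
    cop S (Q.1 * H) ↔ cop S H := by
  unfold cop
  refine forall₂_congr fun Q' hQ' => not_congr ?_
  rw [Q'.prime.dvd_mul, Pr.dvd_iff]
  constructor
  · rintro (h | h)
    · subst h; exact absurd hQ' hQ
    · exact h
  · exact Or.inr

open Classical in
/-- Weight for zeta. -/
noncomputable def wM (S : Finset (Pr F)) (H : F[X]) : ℝ := if cop S H then 1 else 0

open Classical in
lemma PS_wM (S : Finset (Pr F)) :
    PS (wM S) = PS (wM (∅ : Finset (Pr F))) * ∏ Q ∈ S, (1 - PowerSeries.X ^ Q.1.natDegree) := by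
  induction S using Finset.induction_on with
  | empty => simp
  | insert Q S hQ ih =>
    rw [Finset.prod_insert hQ, mul_left_comm, ← ih, sub_mul, one_mul, ← PS_shift _ Q.2.1, ← PS_sub]
    apply PS_congr
    intro H hH
    by_cases h : Q.1 ∣ H
    · obtain ⟨H', rfl⟩ := h
      simp [wM, cop_insert, mul_divByMonic_cancel_left _ Q.2.1, cop_mul S Q hQ]
    · simp [wM, cop_insert, h]

lemma PS_wM_empty : PS (wM (∅ : Finset (Pr F))) =
    PowerSeries.mk fun n => (Fintype.card F : ℝ) ^ n := by
  ext n
  simp [PS, wM, cop, card_mon]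

/-- number of monic prime factors -/
noncomputable def om (H : F[X]) : ℕ := {Q : F[X] | Q.Monic ∧ Irreducible Q ∧ Q ∣ H}.ncard

lemma om_mul (Q : Pr F) {H : F[X]} (hH : H.Monic) (h : ¬ Q.1 ∣ H) : om (Q.1 * H) = om H + 1 := by
  have hf : {Q : F[X] | Q.Monic ∧ Irreducible Q ∧ Q ∣ H}.Finite := by
    refine ((Finset.range (H.natDegree + 1)).finite_toSet.biUnion
      (fun n _ => (mon F n).finite_toSet)).subset ?_
    rintro R ⟨h1, -, h3⟩
    simp only [Set.mem_iUnion]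
    refine ⟨R.natDegree, ?_, ?_⟩
    · have := natDegree_le_of_dvd h3 hH.ne_zero
      simp; omega
    · simpa using mem_mon.2 ⟨h1, rfl⟩
  unfold om
  rw [← Set.ncard_insert_of_notMem (a := Q.1) _ hf]
  · congr 1
    ext R
    simp only [Set.mem_ofPred_eq, Set.mem_insert_iff]
    constructor
    · rintro ⟨h1, h2, h3⟩
      rcases h2.prime.dvd_or_dvd h3 with h4 | h4
      · left
        exact congrArg Subtype.val ((Pr.dvd_iff ⟨R, h1, h2⟩ Q).1 h4)
      · exact Or.inr ⟨h1, h2, h4⟩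
    · rintro (rfl | ⟨h1, h2, h3⟩)
      · exact ⟨Q.2.1, Q.2.2, dvd_mul_right _ _⟩
      · exact ⟨h1, h2, h3.mul_left _⟩
  · exact fun hh => h hh.2.2

open Classical in
/-- Weight for squarefree sum. -/
noncomputable def wA (k : ℕ) (S : Finset (Pr F)) (H : F[X]) : ℝ :=
  if cop S H ∧ Squarefree H then (k : ℝ) ^ om H else 0

lemma sqf_mul (Q : Pr F) {H : F[X]} : Squarefree (Q.1 * H) ↔ ¬ Q.1 ∣ H ∧ Squarefree H := by
  rw [squarefree_mul_iff]
  constructor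
  · rintro ⟨h1, -, h3⟩
    exact ⟨fun h => Q.2.2.not_isUnit (h1 dvd_rfl h), h3⟩
  · rintro ⟨h1, h2⟩
    exact ⟨(Q.2.2.coprime_iff_not_dvd.2 h1).isRelPrime, Q.2.2.squarefree, h2⟩

open Classical in
lemma PS_wA (k : ℕ) (S : Finset (Pr F)) :
    PS (wA k (∅ : Finset (Pr F))) = PS (wA k S) *
      ∏ Q ∈ S, (1 + PowerSeries.C (k : ℝ) * PowerSeries.X ^ Q.1.natDegree) := by
  induction S using Finset.induction_on with
  | empty => simp
  | insert Q S hQ ih =>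
    rw [Finset.prod_insert hQ, ih, ← mul_assoc]
    congr 1
    have : PS (wA k (insert Q S)) * (1 + PowerSeries.C (k : ℝ) * PowerSeries.X ^ Q.1.natDegree) =
      PS (wA k (insert Q S)) + PowerSeries.X ^ Q.1.natDegree *
        PS (fun H => k * wA k (insert Q S) H) := by
      have : PS (fun H => k * wA k (insert Q S) H) =
          PowerSeries.C (k : ℝ) * PS (wA k (insert Q S)) := by
        ext n; rw [PowerSeries.coeff_C_mul]; simp only [PS, PowerSeries.coeff_mk, Finset.mul_sum]
      rw [this]; ring
    rw [this, ← PS_shift _ Q.2.1, ← PS_add]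
    apply PS_congr
    intro H hH
    by_cases h : Q.1 ∣ H
    · obtain ⟨H', rfl⟩ := h
      have hm' : H'.Monic := Q.2.1.of_mul_monic_left hH
      by_cases h' : Q.1 ∣ H'
      · simp [wA, cop_insert, mul_divByMonic_cancel_left _ Q.2.1, cop_mul S Q hQ, sqf_mul, h']
      · simp [wA, cop_insert, mul_divByMonic_cancel_left _ Q.2.1, cop_mul S Q hQ, sqf_mul, h',
          om_mul Q hm' h', pow_succ']
    · simp [wA, cop_insert, h]

lemma Pr_finite (N : ℕ) : {Q : Pr F | Q.1.natDegree ≤ N}.Finite := by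
  apply Set.Finite.of_finite_image (f := Subtype.val) _ Subtype.val_injective.injOn
  refine ((Finset.range (N + 1)).finite_toSet.biUnion
      (fun n _ => (mon F n).finite_toSet)).subset ?_
  rintro _ ⟨R, h1, rfl⟩
  simp only [Set.mem_iUnion]
  refine ⟨R.1.natDegree, ?_, ?_⟩
  · have : R.1.natDegree ≤ N := h1
    simp; omega
  · simpa using mem_mon.2 ⟨R.2.1, rfl⟩

/-- primes of degree at most N -/
noncomputable def SN (F : Type*) [Field F] [Fintype F] (N : ℕ) : Finset (Pr F) :=
  (Pr_finite (F := F) N).toFinset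

lemma mem_SN {N : ℕ} {Q : Pr F} : Q ∈ SN F N ↔ Q.1.natDegree ≤ N := by simp [SN]

lemma not_cop_SN {N : ℕ} {H : F[X]} (hm : H.Monic) (h0 : 0 < H.natDegree) (h : H.natDegree ≤ N) :
    ¬ cop (SN F N) H := by
  intro hc
  obtain ⟨Q, h1, h2, h3⟩ := Polynomial.exists_monic_irreducible_factor H
    (fun hu => by rw [hm.isUnit_iff] at hu; subst hu; simp at h0)
  exact hc ⟨Q, h1, h2⟩ (mem_SN.2 ((natDegree_le_of_dvd h3 hm.ne_zero).trans h)) h3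

lemma mon_zero : mon F 0 = {1} := by
  ext H
  rw [mem_mon, Finset.mem_singleton]
  constructor
  · rintro ⟨h, h'⟩; exact h.natDegree_eq_zero.1 h'
  · rintro rfl; simp

lemma cop_one (S : Finset (Pr F)) : cop S 1 := fun Q _ h => Q.2.2.not_isUnit (isUnit_of_dvd_one h)

lemma om_one : om (1 : F[X]) = 0 := by
  unfold om
  convert Set.ncard_empty F[X]
  ext R
  simp only [Set.mem_ofPred_eq, Set.mem_empty_iff_false, iff_false]
  rintro ⟨-, h2, h3⟩
  exact h2.not_isUnit (isUnit_of_dvd_one h3)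

lemma dvd_of_w {w : F[X] → ℝ} (N : ℕ) (h1 : w 1 = 1) (h : ∀ H, ¬ cop (SN F N) H → w H = 0) :
    PowerSeries.X ^ (N + 1) ∣ PS w - 1 := by
  rw [PowerSeries.X_pow_dvd_iff]
  intro m hm
  rcases Nat.eq_zero_or_pos m with rfl | h0
  · simp [PS, mon_zero, h1]
  · have : ∑ H ∈ mon F m, w H = 0 := by
      refine Finset.sum_eq_zero fun H hH => ?_
      rw [mem_mon] at hH
      exact h H (not_cop_SN hH.1 (by omega) (by omega))
    simp [PS, PowerSeries.coeff_one, h0.ne', this]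

/-- local factor -/
noncomputable def pk (k : ℕ) : ℝ[X] := (1 + C (k : ℝ) * X) * (1 - X) ^ k

/-- The series `A(T) (1-qT)^k`. -/
noncomputable def G (F : Type*) [Field F] [Fintype F] (k : ℕ) : PowerSeries ℝ :=
  PS (wA k (∅ : Finset (Pr F))) * (1 - PowerSeries.C (Fintype.card F : ℝ) * PowerSeries.X) ^ k

/-- Truncated product -/
noncomputable def P (F : Type*) [Field F] [Fintype F] (k N : ℕ) : ℝ[X] :=
  ∏ Q ∈ SN F N, expand ℝ Q.1.natDegree (pk k)

lemma geom (q : ℝ) : (PowerSeries.mk fun n => q ^ n) *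
    (1 - PowerSeries.C q * PowerSeries.X) = 1 := by
  ext n
  rw [mul_sub, mul_one, ← mul_assoc, map_sub]
  rcases n with _ | n
  · simp
  · rw [PowerSeries.coeff_succ_mul_X, PowerSeries.coeff_mul_C]
    simp [PowerSeries.coeff_one, pow_succ]

lemma coeff_G_eq (k N n : ℕ) (hn : n ≤ N) :
    PowerSeries.coeff n (G F k) = (P F k N).coeff n := by
  have hM : PowerSeries.X ^ (N + 1) ∣ PS (wM (SN F N)) - 1 :=
    dvd_of_w N (by simp [wM, cop_one]) (fun H hH => by simp [wM, hH])
  have hA : PowerSeries.X ^ (N + 1) ∣ PS (wA k (SN F N)) - 1 :=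
    dvd_of_w N (by simp [wA, cop_one, om_one]) (fun H hH => by simp [wA, hH])
  have hMk : PowerSeries.X ^ (N + 1) ∣ PS (wM (SN F N)) ^ k - 1 := by
    have := sub_dvd_pow_sub_pow (PS (wM (SN F N))) 1 k
    rw [one_pow] at this
    exact hM.trans this
  have hP : ((P F k N : ℝ[X]) : PowerSeries ℝ) =
      (∏ Q ∈ SN F N, (1 + PowerSeries.C (k : ℝ) * PowerSeries.X ^ Q.1.natDegree)) *
      (∏ Q ∈ SN F N, (1 - PowerSeries.X ^ Q.1.natDegree)) ^ k := by
    rw [← Finset.prod_pow, ← Finset.prod_mul_distrib, P, ← Polynomial.coeToPowerSeries.ringHom_apply,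
      map_prod]
    refine Finset.prod_congr rfl fun Q _ => ?_
    simp only [pk, Polynomial.coeToPowerSeries.ringHom_apply, map_mul, map_pow, map_add, map_sub,
      map_one, expand_C, expand_X, Polynomial.coe_mul, Polynomial.coe_pow, Polynomial.coe_add,
      Polynomial.coe_sub, Polynomial.coe_one, Polynomial.coe_C, Polynomial.coe_X]
  have key : G F k * PS (wM (SN F N)) ^ k = PS (wA k (SN F N)) * (P F k N : PowerSeries ℝ) := by
    have hg := geom (Fintype.card F : ℝ)
    rw [hP, PS_wM, PS_wM_empty, G, PS_wA k (SN F N), mul_pow]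
    have : ∀ a b c z e : PowerSeries ℝ, a * b * c ^ k * (z ^ k * e ^ k) =
      a * (b * e ^ k) * (z * c) ^ k := by intros; ring
    rw [this, hg]; ring
  have : PowerSeries.X ^ (N + 1) ∣ G F k - (P F k N : PowerSeries ℝ) := by
    have e : G F k - (P F k N : PowerSeries ℝ) =
      (P F k N : PowerSeries ℝ) * (PS (wA k (SN F N)) - 1) -
        G F k * (PS (wM (SN F N)) ^ k - 1) := by linear_combination key
    rw [e]
    exact dvd_sub (hA.mul_left _) (hMk.mul_left _)
  rw [PowerSeries.X_pow_dvd_iff] at this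
  have := this n (by omega)
  rw [map_sub, sub_eq_zero] at this
  rw [this, Polynomial.coeff_coe]


/-! Analytic part -/

lemma one_lt_q : (2 : ℝ) ≤ Fintype.card F := by
  exact_mod_cast Fintype.one_lt_card (α := F)

lemma summ {ρ : ℝ} (h0 : 0 ≤ ρ) (h1 : (Fintype.card F : ℝ) * ρ < 1) :
    Summable fun Q : Pr F => ρ ^ Q.1.natDegree := by
  classical
  refine summable_of_sum_le (c := (1 - (Fintype.card F : ℝ) * ρ)⁻¹) (fun Q => by positivity) ?_
  intro s
  obtain ⟨N, hN⟩ : ∃ N, ∀ Q ∈ s, Q.1.natDegree < N :=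
    ⟨s.sup (fun Q => Q.1.natDegree) + 1, fun Q hQ =>
      Nat.lt_succ_of_le (Finset.le_sup (f := fun Q : Pr F => Q.1.natDegree) hQ)⟩
  calc ∑ Q ∈ s, ρ ^ Q.1.natDegree
      = ∑ n ∈ Finset.range N, ∑ Q ∈ s with Q.1.natDegree = n, ρ ^ Q.1.natDegree := by
        rw [Finset.sum_fiberwise_of_maps_to]
        intro Q hQ
        simpa using hN Q hQ
    _ ≤ ∑ n ∈ Finset.range N, ((Fintype.card F : ℝ) * ρ) ^ n := by
        refine Finset.sum_le_sum fun n _ => ?_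
        rw [Finset.sum_congr rfl (g := fun _ => ρ ^ n)
          (fun Q hQ => by rw [(Finset.mem_filter.1 hQ).2])]
        rw [Finset.sum_const, nsmul_eq_mul, mul_pow]
        refine mul_le_mul_of_nonneg_right ?_ (by positivity)
        have : (Finset.filter (fun Q : Pr F => Q.1.natDegree = n) s).card ≤ (mon F n).card := by
          refine Finset.card_le_card_of_injOn Subtype.val ?_ Subtype.val_injective.injOn
          intro Q hQ
          have hQ' := (Finset.mem_filter.1 (Finset.mem_coe.1 hQ)).2
          exact Finset.mem_coe.2 (mem_mon.2 ⟨Q.2.1, hQ'⟩)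
        rw [card_mon] at this
        exact_mod_cast this
    _ ≤ ∑' n, ((Fintype.card F : ℝ) * ρ) ^ n :=
        (summable_geometric_of_lt_one (by positivity) h1).sum_le_tsum _ (fun n _ => by positivity)
    _ = _ := tsum_geometric_of_lt_one (by positivity) h1

lemma pow_decomp (k : ℕ) : ∃ u : ℝ[X], (1 - X) ^ k = 1 - C (k : ℝ) * X + X ^ 2 * u := by
  induction k with
  | zero => exact ⟨0, by simp⟩
  | succ k ih =>
    obtain ⟨u, hu⟩ := ih
    refine ⟨C (k : ℝ) + u * (1 - X), ?_⟩
    rw [pow_succ, hu]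
    push_cast
    rw [C_add, C_1]
    ring

lemma pk_decomp (k : ℕ) : ∃ u : ℝ[X], pk k = 1 + X ^ 2 * u := by
  obtain ⟨u, hu⟩ := pow_decomp k
  refine ⟨-C (k : ℝ) ^ 2 + (1 + C (k : ℝ) * X) * u, ?_⟩
  rw [pk, hu]; ring

/-- coefficientwise absolute value -/
noncomputable def absP (u : ℝ[X]) : ℝ[X] := ∑ n ∈ u.support, monomial n |u.coeff n|

lemma coeff_absP (u : ℝ[X]) (n : ℕ) : (absP u).coeff n = |u.coeff n| := by
  simp only [absP, finsetSum_coeff, coeff_monomial]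
  rw [Finset.sum_ite_eq' u.support n]
  split_ifs with h
  · rfl
  · simp [notMem_support_iff.1 h]

/-- coefficientwise domination -/
def dom (p W : ℝ[X]) : Prop := ∀ n, |p.coeff n| ≤ W.coeff n

lemma dom_mul {p p' W W' : ℝ[X]} (h : dom p W) (h' : dom p' W') : dom (p * p') (W * W') := by
  intro n
  rw [coeff_mul, coeff_mul]
  refine (Finset.abs_sum_le_sum_abs _ _).trans (Finset.sum_le_sum fun i _ => ?_)
  rw [abs_mul]
  exact mul_le_mul (h _) (h' _) (abs_nonneg _) ((abs_nonneg _).trans (h _))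

lemma dom_one : dom 1 1 := by
  intro n; rw [coeff_one]; split_ifs <;> simp

lemma dom_prod {ι : Type*} (s : Finset ι) (p W : ι → ℝ[X]) (h : ∀ i ∈ s, dom (p i) (W i)) :
    dom (∏ i ∈ s, p i) (∏ i ∈ s, W i) := by
  classical
  induction s using Finset.induction_on with
  | empty => simpa using dom_one
  | insert i s hi ih =>
    rw [Finset.prod_insert hi, Finset.prod_insert hi]
    exact dom_mul (h i (by simp)) (ih fun j hj => h j (by simp [hj]))

lemma dom_eval {p W : ℝ[X]} (h : dom p W) {r : ℝ} (hr : 0 ≤ r) (n : ℕ) :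
    |p.coeff n| * r ^ n ≤ W.eval r := by
  have h0 : ∀ i, 0 ≤ W.coeff i := fun i => (abs_nonneg _).trans (h i)
  refine (mul_le_mul_of_nonneg_right (h n) (by positivity)).trans ?_
  rw [eval_eq_sum_range' (n := W.natDegree + n + 1) (by omega)]
  exact Finset.single_le_sum (f := fun i => W.coeff i * r ^ i)
    (fun i _ => mul_nonneg (h0 i) (by positivity)) (Finset.mem_range.2 (by omega))

lemma dom_expand {p W : ℝ[X]} (h : dom p W) {d : ℕ} (hd : 0 < d) :
    dom (expand ℝ d p) (expand ℝ d W) := by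
  intro n
  rw [coeff_expand hd, coeff_expand hd]
  split_ifs
  · exact h _
  · simp

lemma dom_add {p p' W W' : ℝ[X]} (h : dom p W) (h' : dom p' W') : dom (p + p') (W + W') := by
  intro n
  rw [coeff_add, coeff_add]
  exact (abs_add_le _ _).trans (add_le_add (h n) (h' n))

lemma dom_X2 : dom (X ^ 2) (X ^ 2) := by
  intro n; rw [coeff_X_pow]; split_ifs <;> simp

lemma dom_absP (u : ℝ[X]) : dom u (absP u) := fun n => (coeff_absP u n).ge

lemma eval_absP_le (u : ℝ[X]) {y : ℝ} (h0 : 0 ≤ y) (h1 : y ≤ 1) :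
    |u.eval y| ≤ (absP u).eval 1 ∧ (absP u).eval y ≤ (absP u).eval 1 := by
  rw [eval_eq_sum_range' (p := absP u) (n := u.natDegree + (absP u).natDegree + 1) (by omega),
    eval_eq_sum_range' (p := absP u) (n := u.natDegree + (absP u).natDegree + 1) (by omega),
    eval_eq_sum_range' (p := u) (n := u.natDegree + (absP u).natDegree + 1) (by omega)]
  constructor
  · refine (Finset.abs_sum_le_sum_abs _ _).trans (Finset.sum_le_sum fun i _ => ?_)
    rw [abs_mul, coeff_absP, abs_of_nonneg (pow_nonneg h0 i)]
    gcongr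
  · refine Finset.sum_le_sum fun i _ => ?_
    rw [coeff_absP]
    gcongr

lemma P_bound (k : ℕ) : ∃ M : ℝ, 0 ≤ M ∧ ∀ N n,
    |(P F k N).coeff n| * ((Fintype.card F : ℝ)⁻¹) ^ n ≤ M * (4 / 5 : ℝ) ^ n := by
  obtain ⟨u, hu⟩ := pk_decomp k
  have hq := one_lt_q (F := F)
  set q : ℝ := (Fintype.card F : ℝ) with hqd
  have hqp : 0 < q := by linarith
  set r : ℝ := 5 / 4 * q⁻¹ with hr
  have hqi : q⁻¹ ≤ 1 / 2 := by rw [inv_le_comm₀ hqp (by norm_num)]; linarith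
  have hqi0 : 0 < q⁻¹ := by positivity
  have hr0 : 0 ≤ r := by positivity
  have hr1 : r ≤ 1 := by rw [hr]; linarith
  have hs : Summable fun Q : Pr F => (r ^ 2) ^ Q.1.natDegree := by
    apply summ (by positivity)
    have : q * r ^ 2 = 25 / 16 * q⁻¹ := by rw [hr]; field_simp; norm_num
    rw [← hqd, this]; linarith
  set c := (absP u).eval 1 with hc
  have hc0 : 0 ≤ c := (abs_nonneg _).trans (eval_absP_le u zero_le_one le_rfl).1
  refine ⟨Real.exp (c * ∑' Q : Pr F, (r ^ 2) ^ Q.1.natDegree), (Real.exp_pos _).le, fun N n => ?_⟩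
  have hd : dom (P F k N) (∏ Q ∈ SN F N, expand ℝ Q.1.natDegree (1 + X ^ 2 * absP u)) := by
    apply dom_prod
    intro Q _
    apply dom_expand _ Q.pos
    rw [hu]
    exact dom_add dom_one (dom_mul dom_X2 (dom_absP u))
  have h1 := dom_eval hd hr0 n
  have h2 : eval r (∏ Q ∈ SN F N, expand ℝ Q.1.natDegree (1 + X ^ 2 * absP u)) ≤
      Real.exp (c * ∑' Q : Pr F, (r ^ 2) ^ Q.1.natDegree) := by
    rw [eval_prod]
    calc _ ≤ ∏ Q ∈ SN F N, Real.exp (c * (r ^ 2) ^ Q.1.natDegree) := by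
          refine Finset.prod_le_prod ?_ ?_
          · intro Q _
            exact (mul_nonneg (abs_nonneg _) (by positivity)).trans
              (dom_eval (dom_expand (dom_add dom_one (dom_mul dom_X2 (dom_absP u))) Q.pos) hr0 0)
          · intro Q _
            rw [expand_eval]
            simp only [eval_add, eval_one, eval_mul, eval_pow, eval_X]
            have := (eval_absP_le u (pow_nonneg hr0 Q.1.natDegree) (pow_le_one₀ hr0 hr1)).2
            have h3 : (r ^ Q.1.natDegree) ^ 2 = (r ^ 2) ^ Q.1.natDegree := by
              rw [← pow_mul, ← pow_mul, mul_comm]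
            rw [h3, add_comm]
            refine le_trans ?_ (Real.add_one_le_exp _)
            have h4 : 0 ≤ (r ^ 2) ^ Q.1.natDegree := by positivity
            nlinarith
      _ = Real.exp (c * ∑ Q ∈ SN F N, (r ^ 2) ^ Q.1.natDegree) := by
          rw [← Real.exp_sum, Finset.mul_sum]
      _ ≤ _ := by
          apply Real.exp_le_exp.2
          apply mul_le_mul_of_nonneg_left _ hc0
          exact hs.sum_le_tsum _ fun Q _ => by positivity
  have h3 : q⁻¹ ^ n = r ^ n * (4 / 5 : ℝ) ^ n := by
    rw [← mul_pow, hr]; congr 1; ring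
  rw [h3, ← mul_assoc]
  exact mul_le_mul_of_nonneg_right (h1.trans h2) (by positivity)

/-- Euler factor at `Q`. -/
noncomputable def fac (F : Type*) [Field F] [Fintype F] (k : ℕ) (Q : Pr F) : ℝ :=
  (1 + (k : ℝ) * ((Fintype.card F : ℝ) ^ Q.1.natDegree)⁻¹) *
        (1 - ((Fintype.card F : ℝ) ^ Q.1.natDegree)⁻¹) ^ k

lemma fac_eq (k : ℕ) (Q : Pr F) : fac F k Q =
    (expand ℝ Q.1.natDegree (pk k)).eval (Fintype.card F : ℝ)⁻¹ := by
  rw [expand_eval]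
  simp [fac, pk]

lemma fac_pos (k : ℕ) (Q : Pr F) : 0 < fac F k Q := by
  have hq := one_lt_q (F := F)
  have : ((Fintype.card F : ℝ) ^ Q.1.natDegree)⁻¹ < 1 :=
    inv_lt_one_of_one_lt₀ (one_lt_pow₀ (by linarith) Q.pos.ne')
  have : 0 < 1 - ((Fintype.card F : ℝ) ^ Q.1.natDegree)⁻¹ := by linarith
  unfold fac
  positivity

lemma fac_summable (k : ℕ) : Summable fun Q : Pr F => fac F k Q - 1 := by
  obtain ⟨u, hu⟩ := pk_decomp k
  have hq := one_lt_q (F := F)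
  set q : ℝ := (Fintype.card F : ℝ) with hqd
  have hqp : 0 < q := by linarith
  have hqi : q⁻¹ ≤ 1 / 2 := by rw [inv_le_comm₀ hqp (by norm_num)]; linarith
  have hqi0 : 0 < q⁻¹ := by positivity
  have hs : Summable fun Q : Pr F => (q⁻¹ ^ 2) ^ Q.1.natDegree := by
    apply summ (by positivity)
    have : q * q⁻¹ ^ 2 = q⁻¹ := by field_simp
    rw [← hqd, this]; linarith
  refine Summable.of_norm_bounded (hs.mul_left ((absP u).eval 1)) fun Q => ?_
  rw [fac_eq, expand_eval, hu, ← hqd]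
  simp only [eval_add, eval_one, eval_mul, eval_pow, eval_X, add_sub_cancel_left]
  have := (eval_absP_le u (pow_nonneg hqi0.le Q.1.natDegree)
    (pow_le_one₀ hqi0.le (by linarith))).1
  have h3 : (q⁻¹ ^ Q.1.natDegree) ^ 2 = (q⁻¹ ^ 2) ^ Q.1.natDegree := by
    rw [← pow_mul, ← pow_mul, mul_comm]
  rw [h3, norm_mul, Real.norm_eq_abs, Real.norm_eq_abs, abs_of_nonneg (by positivity), mul_comm]
  exact mul_le_mul_of_nonneg_right this (by positivity)

lemma fac_mult (k : ℕ) : Multipliable (fac F k) := by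
  have := Real.multipliable_one_add_of_summable (fac_summable (F := F) k)
  simpa using this

lemma tprod_pos (k : ℕ) : 0 < ∏' Q, fac F k Q := by
  rw [← Real.rexp_tsum_eq_tprod (fac_pos k)]
  · exact Real.exp_pos _
  · simpa using Real.summable_log_one_add_of_summable (fac_summable (F := F) k)

lemma SN_tendsto : Tendsto (SN F) atTop atTop := by
  refine tendsto_atTop_finset_of_monotone ?_ ?_
  · intro a b hab Q hQ
    rw [mem_SN] at *
    omega
  · intro Q
    exact ⟨Q.1.natDegree, mem_SN.2 le_rfl⟩

lemma eval_eq_tsum (p : ℝ[X]) (x : ℝ) : p.eval x = ∑' n, p.coeff n * x ^ n := by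
  rw [eval_eq_sum_range, tsum_eq_sum]
  intro n hn
  rw [coeff_eq_zero_of_natDegree_lt, zero_mul]
  simpa [Nat.lt_succ_iff] using hn

/-- normalised coefficients -/
noncomputable def g (F : Type*) [Field F] [Fintype F] (k n : ℕ) : ℝ :=
  PowerSeries.coeff n (G F k) * ((Fintype.card F : ℝ)⁻¹) ^ n

lemma geo_summable : Summable fun n : ℕ => (4 / 5 : ℝ) ^ n :=
  summable_geometric_of_lt_one (by norm_num) (by norm_num)

lemma tsum_g (k : ℕ) : ∑' n, g F k n = ∏' Q, fac F k Q := by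
  obtain ⟨M, hM0, hM⟩ := P_bound (F := F) k
  have h1 : Tendsto (fun N => (P F k N).eval (Fintype.card F : ℝ)⁻¹) atTop
      (𝓝 (∏' Q, fac F k Q)) := by
    have := (fac_mult (F := F) k).hasProd.comp SN_tendsto
    refine this.congr fun N => ?_
    simp only [Function.comp, P, eval_prod, fac_eq]
  have h2 : Tendsto (fun N => (P F k N).eval (Fintype.card F : ℝ)⁻¹) atTop
      (𝓝 (∑' n, g F k n)) := by
    simp_rw [eval_eq_tsum]
    refine tendsto_tsum_of_dominated_convergence (geo_summable.mul_left M) ?_ ?_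
    · intro n
      refine tendsto_const_nhds.congr' ?_
      filter_upwards [eventually_ge_atTop n] with N hN
      rw [g, coeff_G_eq k N n hN]
    · refine Eventually.of_forall fun N n => ?_
      rw [norm_mul, Real.norm_eq_abs, Real.norm_eq_abs,
        abs_of_nonneg (a := (_ : ℝ) ^ n) (by positivity)]
      exact hM N n
  exact tendsto_nhds_unique h2 h1

lemma g_bound (k : ℕ) : ∃ M : ℝ, 0 ≤ M ∧ ∀ n, |g F k n| ≤ M * (4 / 5 : ℝ) ^ n := by
  obtain ⟨M, hM0, hM⟩ := P_bound (F := F) k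
  refine ⟨M, hM0, fun n => ?_⟩
  rw [g, coeff_G_eq k n n le_rfl, abs_mul, abs_of_nonneg (a := (_ : ℝ) ^ n) (by positivity)]
  exact hM n n

lemma mk_pow (q : ℝ) (K : ℕ) : (PowerSeries.mk fun n => q ^ n) ^ (K + 1) =
    PowerSeries.mk fun n => q ^ n * ((K + n).choose K : ℝ) := by
  have : (PowerSeries.mk fun n => q ^ n) = PowerSeries.rescale q (PowerSeries.mk 1) := by
    ext n; simp
  rw [this, ← map_pow, PowerSeries.mk_one_pow_eq_mk_choose_add]
  ext n; simp

lemma coeff_A (K m : ℕ) : (∑ H ∈ mon F m, wA (K + 1) ∅ H) / (Fintype.card F : ℝ) ^ m =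
    ∑ i ∈ Finset.range (m + 1), g F (K + 1) i * ((K + (m - i)).choose K : ℝ) := by
  have hq : (Fintype.card F : ℝ) ≠ 0 := by have := one_lt_q (F := F); positivity
  have : PS (wA (K + 1) (∅ : Finset (Pr F))) =
      G F (K + 1) * (PowerSeries.mk fun n => (Fintype.card F : ℝ) ^ n) ^ (K + 1) := by
    rw [G, mul_assoc, ← mul_pow, mul_comm (1 - _), geom, one_pow, mul_one]
  have h := congrArg (PowerSeries.coeff m) this
  rw [mk_pow, PowerSeries.coeff_mul, Finset.Nat.sum_antidiagonal_eq_sum_range_succ_mk] at h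
  simp only [PS, PowerSeries.coeff_mk] at h
  rw [h, Finset.sum_div]
  refine Finset.sum_congr rfl fun i hi => ?_
  have : i ≤ m := by simpa [Nat.lt_succ_iff] using hi
  have e : (Fintype.card F : ℝ) ^ m = (Fintype.card F : ℝ) ^ i * (Fintype.card F : ℝ) ^ (m - i) := by
    rw [← pow_add]; congr 1; omega
  rw [g, e, inv_pow]
  field_simp

lemma choose_tendsto (K i : ℕ) :
    Tendsto (fun m : ℕ => ((K + (m - i)).choose K : ℝ) / (m : ℝ) ^ K) atTop
      (𝓝 (1 / K.factorial)) := by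
  have ht : Tendsto (fun m : ℕ => K + (m - i)) atTop atTop :=
    tendsto_atTop_mono (fun m => Nat.le_add_left _ _) (tendsto_sub_atTop_nat i)
  have h1 := (isEquivalent_choose K).comp_tendsto ht
  have hlin : Tendsto (fun m : ℕ => ((K + (m - i) : ℕ) : ℝ) / m) atTop (𝓝 1) := by
    have h : Tendsto (fun m : ℕ => 1 + ((K : ℝ) - i) / m) atTop (𝓝 (1 + 0)) :=
      tendsto_const_nhds.add (tendsto_const_div_atTop_nhds_zero_nat _)
    rw [add_zero] at h
    refine h.congr' ?_
    filter_upwards [eventually_ge_atTop i, eventually_gt_atTop 0] with m hm hm0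
    push_cast [Nat.cast_sub hm]
    have : (m : ℝ) ≠ 0 := by positivity
    field_simp
    ring
  have h2 : Tendsto (fun m : ℕ => (((K + (m - i) : ℕ) : ℝ) ^ K / K.factorial) / (m : ℝ) ^ K) atTop
      (𝓝 (1 / K.factorial)) := by
    have := (hlin.pow K).div_const (K.factorial : ℝ)
    rw [one_pow] at this
    refine this.congr fun m => ?_
    rw [div_pow]; ring
  have h3 := h1.div (Asymptotics.IsEquivalent.refl (u := fun m : ℕ => (m : ℝ) ^ K))
  exact h3.symm.tendsto_nhds h2

lemma choose_bound (K i m : ℕ) (hm : 1 ≤ m) :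
    ((K + (m - i)).choose K : ℝ) / (m : ℝ) ^ K ≤ ((K : ℝ) + 1) ^ K := by
  have hm' : (1 : ℝ) ≤ m := by exact_mod_cast hm
  rw [div_le_iff₀ (by positivity), ← mul_pow]
  have h1 : ((K + (m - i)).choose K : ℝ) ≤ ((K + (m - i) : ℕ) : ℝ) ^ K := by
    exact_mod_cast Nat.choose_le_pow _ _
  refine h1.trans (pow_le_pow_left₀ (by positivity) ?_ _)
  have : ((K + (m - i) : ℕ) : ℝ) ≤ ((K + m : ℕ) : ℝ) := by
    exact_mod_cast (by omega : K + (m - i) ≤ K + m)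
  push_cast at this ⊢
  nlinarith [(Nat.cast_nonneg K : (0 : ℝ) ≤ K)]

lemma main_lim (K : ℕ) : Tendsto (fun m : ℕ =>
    (∑ H ∈ mon F m, wA (K + 1) ∅ H) / ((Fintype.card F : ℝ) ^ m * (m : ℝ) ^ K)) atTop
      (𝓝 ((∏' Q, fac F (K + 1) Q) / K.factorial)) := by
  obtain ⟨M, hM0, hM⟩ := g_bound (F := F) (K + 1)
  have key : Tendsto (fun m : ℕ => ∑' i, (if i ≤ m then
      g F (K + 1) i * (((K + (m - i)).choose K : ℝ) / (m : ℝ) ^ K) else 0)) atTop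
      (𝓝 (∑' i, g F (K + 1) i * (1 / K.factorial))) := by
    refine tendsto_tsum_of_dominated_convergence
      (geo_summable.mul_left (M * ((K : ℝ) + 1) ^ K)) ?_ ?_
    · intro i
      refine ((choose_tendsto K i).const_mul (g F (K + 1) i)).congr' ?_
      filter_upwards [eventually_ge_atTop i] with m hm
      rw [if_pos hm]
    · filter_upwards [eventually_ge_atTop 1] with m hm i
      split_ifs
      · rw [norm_mul, Real.norm_eq_abs, Real.norm_eq_abs, abs_of_nonneg (a := _ / _) (by positivity),
          mul_right_comm]
        exact mul_le_mul (hM i) (choose_bound K i m hm) (by positivity) (by positivity)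
      · rw [norm_zero]; positivity
  rw [tsum_mul_right, tsum_g, mul_one_div] at key
  refine key.congr fun m => ?_
  rw [← div_div, coeff_A, Finset.sum_div, tsum_eq_sum (s := Finset.range (m + 1))]
  · refine Finset.sum_congr rfl fun i hi => ?_
    rw [if_pos (by simpa [Nat.lt_succ_iff] using hi), mul_div_assoc]
  · intro i hi
    rw [if_neg]
    simpa [Nat.lt_succ_iff] using hi

end
end S8

/-- Over a finite field `𝔽_q`, for `k ≥ 1`, let `a_k(m) = ∑_H k^{ω(H)}` over monic
squarefree `H` of degree `m`. Then `a_k(m)/(q^m · m^{k-1}) → φ_k/(k-1)!` as `m → ∞`,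
where `φ_k = ∏_Q (1 + k·|Q|^{-1})·(1 - |Q|^{-1})^k` over monic irreducible `Q`
(the family being multipliable and the product positive). -/
theorem stmt_8 (Fq : Type*) [Field Fq] [Fintype Fq] (k : ℕ) (hk : 1 ≤ k)
    (ω : Fq[X] → ℕ)
    (hω : ∀ H : Fq[X], ω H = {Q : Fq[X] | Q.Monic ∧ Irreducible Q ∧ Q ∣ H}.ncard)
    (a : ℕ → ℕ)
    (ha : ∀ m : ℕ, a m =
      ∑ᶠ H ∈ {H : Fq[X] | H.Monic ∧ Squarefree H ∧ H.natDegree = m}, k ^ ω H) :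
    Multipliable (fun Q : {Q : Fq[X] // Q.Monic ∧ Irreducible Q} =>
      (1 + (k : ℝ) * ((Fintype.card Fq : ℝ) ^ Q.1.natDegree)⁻¹) *
        (1 - ((Fintype.card Fq : ℝ) ^ Q.1.natDegree)⁻¹) ^ k) ∧
    0 < ∏' Q : {Q : Fq[X] // Q.Monic ∧ Irreducible Q},
      ((1 + (k : ℝ) * ((Fintype.card Fq : ℝ) ^ Q.1.natDegree)⁻¹) *
        (1 - ((Fintype.card Fq : ℝ) ^ Q.1.natDegree)⁻¹) ^ k) ∧
    Tendsto (fun m : ℕ =>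
        (a m : ℝ) / ((Fintype.card Fq : ℝ) ^ m * (m : ℝ) ^ (k - 1)))
      atTop
      (𝓝 ((∏' Q : {Q : Fq[X] // Q.Monic ∧ Irreducible Q},
        ((1 + (k : ℝ) * ((Fintype.card Fq : ℝ) ^ Q.1.natDegree)⁻¹) *
          (1 - ((Fintype.card Fq : ℝ) ^ Q.1.natDegree)⁻¹) ^ k)) / (k - 1).factorial)) := by
  classical
  refine ⟨S8.fac_mult k, S8.tprod_pos k, ?_⟩
  obtain ⟨K, rfl⟩ : ∃ K, k = K + 1 := ⟨k - 1, by omega⟩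
  have h := S8.main_lim (F := Fq) K
  simp only [Nat.add_sub_cancel]
  refine h.congr fun m => ?_
  congr 1
  rw [ha m]
  have hs : ({H : Fq[X] | H.Monic ∧ Squarefree H ∧ H.natDegree = m} : Set Fq[X]) =
      ((S8.mon Fq m).filter (fun H => Squarefree H) : Finset Fq[X]) := by
    ext H
    simp only [Set.mem_ofPred_eq, Finset.coe_filter, S8.mem_mon]
    tauto
  rw [hs, finsum_mem_coe_finset, Nat.cast_sum, Finset.sum_filter]
  refine Finset.sum_congr rfl fun H _ => ?_
  have hc : S8.cop (∅ : Finset (S8.Pr Fq)) H := by simp [S8.cop]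
  simp [S8.wA, hc, hω, S8.om]
end

section
/- Fix a finite field 𝔽_q and an integer k ≥ 1. For each integer m ≥ 0, let a_k(m) = ∑_H k^{ω(H)}, the sum over all monic squarefree polynomials H ∈ 𝔽_q[x] of degree m. Then there exist real constants 0 < c ≤ C and X₀ > 1 such that for all real X ≥ X₀: c·X·(log X / log q)^{k-1} ≤ ∑_{m ∈ ℕ, q^m ≤ X} a_k(m) ≤ C·X·(log X / log q)^{k-1}. -/
open Polynomial

section Helpers
variable {Fq : Type*} [Field Fq]

lemma monic_split_mul {A B C : Fq[X]} (hA : A.Monic) (hB : B.Monic) (hC : C.Monic)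
    (h : A ∣ B * C) : ∃ A₁ A₂ : Fq[X], A₁.Monic ∧ A₂.Monic ∧ A₁ ∣ B ∧ A₂ ∣ C ∧ A = A₁ * A₂ := by
  classical
  obtain ⟨a, b, ha, hb, rfl⟩ := exists_dvd_and_dvd_of_dvd_mul h
  have ha0 : a ≠ 0 := ne_zero_of_dvd_ne_zero hB.ne_zero ha
  have hb0 : b ≠ 0 := ne_zero_of_dvd_ne_zero hC.ne_zero hb
  refine ⟨normalize a, normalize b, monic_normalize ha0, monic_normalize hb0,
    normalize_dvd_iff.2 ha, normalize_dvd_iff.2 hb, ?_⟩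
  exact eq_of_monic_of_associated hA ((monic_normalize ha0).mul (monic_normalize hb0))
    ((normalize_associated a).symm.mul_mul (normalize_associated b).symm)

lemma monic_of_mul_monic {A B : Fq[X]} (hA : A.Monic) (h : (A * B).Monic) : B.Monic :=
  hA.of_mul_monic_left h

lemma monic_split_prod : ∀ (l : ℕ) (A : Fq[X]) (B : Fin l → Fq[X]), A.Monic →
    (∀ j, (B j).Monic) → A ∣ ∏ j, B j →
    ∃ C D : Fin l → Fq[X], (∀ j, (C j).Monic) ∧ (∀ j, (D j).Monic) ∧
      (∀ j, B j = C j * D j) ∧ A = ∏ j, C j := by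
  intro l
  induction l with
  | zero =>
    intro A B hA hB h
    refine ⟨fun _ => 1, fun _ => 1, by simp, by simp, fun j => j.elim0, ?_⟩
    simp only [Finset.univ_eq_empty, Finset.prod_empty] at h ⊢
    exact hA.eq_one_of_isUnit (isUnit_of_dvd_one h)
  | succ l ih =>
    intro A B hA hB h
    rw [Fin.prod_univ_succ] at h
    obtain ⟨A₁, A₂, h1, h2, ⟨D₀, hD₀⟩, hd2, rfl⟩ := monic_split_mul hA (hB 0)
      (monic_prod_of_monic _ _ fun j _ => hB _) h
    obtain ⟨C, D, hC, hD, hB', hp⟩ := ih A₂ (fun j => B j.succ) h2 (fun j => hB _) hd2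
    refine ⟨Fin.cons A₁ C, Fin.cons D₀ D, ?_, ?_, ?_, ?_⟩
    · intro j; refine Fin.cases ?_ ?_ j <;> simp [h1, hC]
    · intro j
      refine Fin.cases ?_ ?_ j
      · simpa using h1.of_mul_monic_left (hD₀ ▸ hB 0)
      · simpa using hD
    · intro j
      refine Fin.cases ?_ ?_ j
      · simpa using hD₀
      · simpa using hB'
    · rw [Fin.prod_univ_succ]; simp [hp]

lemma monic_refine : ∀ (k l : ℕ) (A : Fin k → Fq[X]) (B : Fin l → Fq[X]),
    (∀ i, (A i).Monic) → (∀ j, (B j).Monic) → ∏ i, A i = ∏ j, B j →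
    ∃ C : Fin k → Fin l → Fq[X], (∀ i j, (C i j).Monic) ∧
      (∀ i, A i = ∏ j, C i j) ∧ (∀ j, B j = ∏ i, C i j) := by
  intro k l
  induction k with
  | zero =>
    intro A B hA hB h
    refine ⟨fun _ _ => 1, by simp, fun j => j.elim0, fun j => ?_⟩
    simp only [Finset.univ_eq_empty, Finset.prod_empty] at h ⊢
    exact (hB j).eq_one_of_isUnit
      (isUnit_of_dvd_one (h ▸ Finset.dvd_prod_of_mem B (Finset.mem_univ j)))
  | succ k ih =>
    intro A B hA hB h
    rw [Fin.prod_univ_succ] at h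
    obtain ⟨C₀, D, hC₀, hD, hBD, hA0⟩ := monic_split_prod l (A 0) B (hA 0) hB (Dvd.intro _ h)
    have h' : ∏ i : Fin k, A i.succ = ∏ j, D j := by
      simp only [hBD, Finset.prod_mul_distrib, ← hA0] at h
      exact mul_left_cancel₀ (hA 0).ne_zero h
    obtain ⟨C, hC, hAC, hBC⟩ := ih (fun i => A i.succ) D (fun i => hA _) hD h'
    refine ⟨Fin.cons C₀ C, ?_, ?_, ?_⟩
    · intro i j; refine Fin.cases ?_ (fun i => ?_) i <;> simp [hC₀, hC]
    · intro i
      refine Fin.cases ?_ (fun i => ?_) i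
      · simpa using hA0
      · simpa using hAC i
    · intro j
      rw [Fin.prod_univ_succ]
      simp [hBD j, hBC j]

lemma monic_sq_decomp : ∀ (n : ℕ) (P : Fq[X]), P.Monic → P.natDegree = n →
    ∃ H S : Fq[X], H.Monic ∧ S.Monic ∧ Squarefree H ∧ P = H * S * S := by
  classical
  intro n
  induction n using Nat.strong_induction_on with
  | _ n ih =>
    intro P hP hn
    by_cases hs : Squarefree P
    · exact ⟨P, 1, hP, monic_one, hs, by simp⟩
    · unfold Squarefree at hs
      push Not at hs
      obtain ⟨T, hT, hu⟩ := hs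
      have hT0 : T ≠ 0 := by
        rintro rfl
        simp at hT
        exact hP.ne_zero hT
      have hTm := monic_normalize hT0
      have hT' : normalize T * normalize T ∣ P := by
        exact ((normalize_associated T).mul_mul (normalize_associated T)).dvd.trans hT
      have hu' : ¬ IsUnit (normalize T) := by rwa [normalize_associated T |>.isUnit_iff]
      generalize normalize T = U at *
      obtain ⟨Q, rfl⟩ := hT'
      have hQ : Q.Monic := (hTm.mul hTm).of_mul_monic_left hP
      have hUd : 0 < U.natDegree := by
        rw [Nat.pos_iff_ne_zero]
        intro h0
        exact hu' (by rw [hTm.natDegree_eq_zero.1 h0]; exact isUnit_one)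
      rw [(hTm.mul hTm).natDegree_mul hQ, hTm.natDegree_mul hTm] at hn
      obtain ⟨H, S, hH, hS, hsq, rfl⟩ := ih Q.natDegree (by omega) Q hQ rfl
      exact ⟨H, S * U, hH, hS.mul hTm, hsq, by ring⟩

lemma tuple_decomp (k : ℕ) (F : Fin k → Fq[X]) (hF : ∀ i, (F i).Monic) :
    ∃ (G : Fin k → Fq[X]) (E : Fin k × Fin k → Fq[X]), (∀ i, (G i).Monic) ∧ (∀ p, (E p).Monic) ∧
      Squarefree (∏ i, G i) ∧ F = (fun i => G i * (∏ j, E (i, j)) * ∏ j, E (j, i)) := by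
  have hPm : (∏ i, F i).Monic := monic_prod_of_monic _ _ fun j _ => hF _
  obtain ⟨H, S, hH, hS, hsq, hP⟩ := monic_sq_decomp _ (∏ i, F i) hPm rfl
  obtain ⟨C, hC, hFC, hBC⟩ := monic_refine k 3 F ![H, S, S] hF
    (by intro j; fin_cases j <;> simp [hH, hS]) (by rw [hP, Fin.prod_univ_three]; simp)
  have h0 : H = ∏ i, C i 0 := hBC 0
  have h1 : S = ∏ i, C i 1 := hBC 1
  have h2 : S = ∏ i, C i 2 := hBC 2
  obtain ⟨E, hE, hE1, hE2⟩ := monic_refine k k (fun i => C i 1) (fun i => C i 2)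
    (fun i => hC _ _) (fun i => hC _ _) (h1.symm.trans h2)
  refine ⟨fun i => C i 0, fun p => E p.1 p.2, fun i => hC _ _, fun p => hE _ _, h0 ▸ hsq, ?_⟩
  funext i
  rw [hFC i, Fin.prod_univ_three]
  exact congrArg₂ (fun x y => C i 0 * x * y) (hE1 i) (hE2 i)


lemma exists_primeFin (H : Fq[X]) (hH : H.Monic) : ∃ S : Finset Fq[X],
    (∀ P, P ∈ S ↔ Irreducible P ∧ P.Monic ∧ P ∣ H) ∧ (Squarefree H → ∏ P ∈ S, P = H) := by
  classical
  refine ⟨(UniqueFactorizationMonoid.normalizedFactors H).toFinset, fun P => ?_, fun hs => ?_⟩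
  · rw [Multiset.mem_toFinset, Polynomial.mem_normalizedFactors_iff hH.ne_zero]
  · have hn := (UniqueFactorizationMonoid.squarefree_iff_nodup_normalizedFactors hH.ne_zero).1 hs
    rw [Finset.prod, Multiset.toFinset_val, hn.dedup, Multiset.map_id',
      UniqueFactorizationMonoid.prod_normalizedFactors_eq hH.ne_zero, hH.normalize_eq_self]

lemma monic_irr_eq {P Q : Fq[X]} (hP : Irreducible P) (hQ : Irreducible Q) (hPm : P.Monic)
    (hQm : Q.Monic) (h : P ∣ Q) : P = Q :=
  eq_of_monic_of_associated hPm hQm (hP.associated_of_dvd hQ h)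

variable [Fintype Fq]

variable (Fq) in
lemma monic_deg_card (n : ℕ) :
    Nat.card {p : Fq[X] // p.Monic ∧ p.natDegree = n} = Fintype.card Fq ^ n := by
  rw [Nat.card_congr ((monicEquivDegreeLT n).trans (degreeLTEquiv Fq n).toEquiv)]
  simp

variable (Fq) in
lemma monic_deg_finite (n : ℕ) : {p : Fq[X] | p.Monic ∧ p.natDegree = n}.Finite := by
  apply Nat.finite_of_card_ne_zero
  have := monic_deg_card Fq n
  change Nat.card {p : Fq[X] // p.Monic ∧ p.natDegree = n} ≠ 0
  rw [this]
  exact pow_ne_zero _ Fintype.card_ne_zero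

variable (Fq) in
/-- monic polynomials of degree n -/
noncomputable def monFin (n : ℕ) : Finset Fq[X] := (monic_deg_finite Fq n).toFinset

lemma mem_monFin {n : ℕ} {p : Fq[X]} : p ∈ monFin Fq n ↔ p.Monic ∧ p.natDegree = n := by
  simp [monFin]

variable (Fq) in
lemma card_monFin (n : ℕ) : (monFin Fq n).card = Fintype.card Fq ^ n := by
  rw [← monic_deg_card Fq n, monFin, ← Set.ncard_eq_toFinset_card _ (monic_deg_finite Fq n)]
  rfl

open Classical in
variable (Fq) in
/-- tuples of monic polynomials of total degree m -/
noncomputable def tupFin (ι : Type) [Fintype ι] (m : ℕ) : Finset (ι → Fq[X]) :=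
  (Finset.piAntidiag Finset.univ m).biUnion fun d => Fintype.piFinset fun i => monFin Fq (d i)

lemma mem_tupFin {ι : Type} [Fintype ι] {m : ℕ} {F : ι → Fq[X]} :
    F ∈ tupFin Fq ι m ↔ (∀ i, (F i).Monic) ∧ ∑ i, (F i).natDegree = m := by
  simp only [tupFin, Finset.mem_biUnion, Finset.mem_piAntidiag, Fintype.mem_piFinset, mem_monFin]
  constructor
  · rintro ⟨d, ⟨h1, -⟩, h2⟩
    refine ⟨fun i => (h2 i).1, ?_⟩
    rw [← h1]
    exact Finset.sum_congr rfl fun i _ => (h2 i).2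
  · rintro ⟨h1, h2⟩
    exact ⟨fun i => (F i).natDegree, ⟨h2, by simp⟩, fun i => ⟨h1 i, rfl⟩⟩

variable (Fq) in
lemma card_tupFin (ι : Type) [Fintype ι] [Nonempty ι] (m : ℕ) :
    (tupFin Fq ι m).card =
      Fintype.card Fq ^ m * (m + (Fintype.card ι - 1)).choose (Fintype.card ι - 1) := by
  classical
  have hpos : 0 < Fintype.card ι := Fintype.card_pos
  have h1 : (Finset.piAntidiag (Finset.univ : Finset ι) m).card =
      (m + (Fintype.card ι - 1)).choose (Fintype.card ι - 1) := by
    rw [show m + (Fintype.card ι - 1) = Fintype.card ι + m - 1 by omega,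
      Nat.choose_symm_of_eq_add (b := m) (by omega), ← Sym.card_sym_eq_choose (α := ι) m]
    rw [← Fintype.card_coe]
    refine Fintype.card_congr (Equiv.trans ?_ (Sym.equivNatSumOfFintype ι m).symm)
    exact Equiv.subtypeEquivRight (by simp)
  rw [tupFin]
  convert Finset.card_biUnion (s := Finset.piAntidiag (Finset.univ : Finset ι) m)
    (t := fun d => Fintype.piFinset fun i => monFin Fq (d i)) ?_ using 1
  · rw [Finset.sum_congr rfl (g := fun _ => Fintype.card Fq ^ m), Finset.sum_const, h1, smul_eq_mul,
      mul_comm]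
    intro d hd
    rw [Fintype.card_piFinset]
    simp only [card_monFin]
    rw [Finset.prod_pow_eq_pow_sum, (Finset.mem_piAntidiag.1 hd).1]
  · intro d _ d' _ hne
    change Disjoint _ _
    rw [Finset.disjoint_left]
    intro F hF hF'
    apply hne
    funext i
    rw [Fintype.mem_piFinset] at hF hF'
    rw [← (mem_monFin.1 (hF i)).2, ← (mem_monFin.1 (hF' i)).2]

variable (Fq) in
open Classical in
/-- tuples with squarefree product -/
noncomputable def sqfTup (k m : ℕ) : Finset (Fin k → Fq[X]) :=
  (tupFin Fq (Fin k) m).filter fun G => Squarefree (∏ i, G i)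

variable (Fq) in
lemma card_tup_le (k m : ℕ) : (tupFin Fq (Fin k) m).card ≤
    ∑ s ∈ Finset.range (m / 2 + 1),
      (sqfTup Fq k (m - 2 * s)).card * (tupFin Fq (Fin k × Fin k) s).card := by
  classical
  have hsub : tupFin Fq (Fin k) m ⊆ (Finset.range (m / 2 + 1)).biUnion fun s =>
      (sqfTup Fq k (m - 2 * s) ×ˢ tupFin Fq (Fin k × Fin k) s).image
        fun p i => p.1 i * (∏ j, p.2 (i, j)) * ∏ j, p.2 (j, i) := by
    intro F hF
    obtain ⟨hm, hd⟩ := mem_tupFin.1 hF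
    obtain ⟨G, E, hG, hE, hsq, rfl⟩ := tuple_decomp k F hm
    have hdeg : ∑ i, (G i).natDegree + 2 * ∑ p, (E p).natDegree = m := by
      rw [← hd]
      have : ∀ i, (G i * (∏ j, E (i, j)) * ∏ j, E (j, i)).natDegree =
          (G i).natDegree + ∑ j, (E (i, j)).natDegree + ∑ j, (E (j, i)).natDegree := by
        intro i
        have h1 : (∏ j, E (i, j)).Monic := monic_prod_of_monic _ _ fun j _ => hE _
        have h2 : (∏ j, E (j, i)).Monic := monic_prod_of_monic _ _ fun j _ => hE _
        rw [((hG i).mul h1).natDegree_mul h2, (hG i).natDegree_mul h1,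
          natDegree_prod_of_monic _ _ fun j _ => hE _, natDegree_prod_of_monic _ _ fun j _ => hE _]
      simp only [this, Finset.sum_add_distrib]
      rw [Finset.sum_comm (f := fun i j => (E (j, i)).natDegree), Fintype.sum_prod_type]
      ring
    simp only [Finset.mem_biUnion, Finset.mem_range, Finset.mem_image, Finset.mem_product]
    refine ⟨∑ p, (E p).natDegree, by omega, (G, E), ⟨?_, ?_⟩, rfl⟩
    · simp only [sqfTup, Finset.mem_filter, mem_tupFin]
      exact ⟨⟨hG, by omega⟩, hsq⟩
    · exact mem_tupFin.2 ⟨hE, rfl⟩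
  refine (Finset.card_le_card hsub).trans (Finset.card_biUnion_le.trans ?_)
  refine Finset.sum_le_sum fun s _ => Finset.card_image_le.trans ?_
  rw [Finset.card_product]
open Classical in
lemma card_fact (k m : ℕ) (H : Fq[X]) (hH : H.Monic) (hs : Squarefree H) (hm : H.natDegree = m) :
    ((tupFin Fq (Fin k) m).filter fun G => ∏ i, G i = H).card =
      k ^ {Q : Fq[X] | Q.Monic ∧ Irreducible Q ∧ Q ∣ H}.ncard := by
  obtain ⟨S, hS, hSp⟩ := exists_primeFin H hH
  have hSp := hSp hs
  have e1 : {Q : Fq[X] | Q.Monic ∧ Irreducible Q ∧ Q ∣ H} = (S : Set Fq[X]) := by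
    ext Q; simp only [Set.mem_ofPred_eq, Finset.mem_coe, hS]; tauto
  rw [e1, Set.ncard_coe_finset]
  let φ : (S → Fin k) → (Fin k → Fq[X]) := fun f i => ∏ P ∈ Finset.univ.filter (fun P => f P = i), P.1
  have hφ : ∀ f i (P : S), P.1 ∣ φ f i ↔ f P = i := by
    intro f i P
    have hP := (hS P.1).1 P.2
    constructor
    · intro h
      obtain ⟨P', hP', hd⟩ := hP.1.prime.exists_mem_finset_dvd h
      have hP2 := (hS P'.1).1 P'.2
      have : P = P' := Subtype.ext (monic_irr_eq hP.1 hP2.1 hP.2.1 hP2.2.1 hd)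
      rw [this]; simpa using hP'
    · intro h
      exact Finset.dvd_prod_of_mem (fun P : S => P.1) (by simpa using h)
  have hinj : Function.Injective φ := by
    intro f g hfg
    funext P
    have := (hφ f (f P) P).2 rfl
    rw [hfg, hφ] at this
    exact this.symm
  have himg : ((tupFin Fq (Fin k) m).filter fun G => ∏ i, G i = H) = Finset.univ.image φ := by
    ext G
    simp only [Finset.mem_filter, mem_tupFin, Finset.mem_image, Finset.mem_univ, true_and]
    constructor
    · rintro ⟨⟨hGm, -⟩, hG⟩
      have hex : ∀ P : S, ∃ i, P.1 ∣ G i := by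
        intro P
        have hP := (hS P.1).1 P.2
        have hd := hP.2.2
        rw [← hG] at hd
        obtain ⟨i, -, hi⟩ := hP.1.prime.exists_mem_finset_dvd hd
        exact ⟨i, hi⟩
      choose f hf using hex
      refine ⟨f, ?_⟩
      funext i
      obtain ⟨T, hT, hTp⟩ := exists_primeFin (G i) (hGm i)
      have hGi : G i ∣ H := hG ▸ Finset.dvd_prod_of_mem G (Finset.mem_univ i)
      rw [← hTp (hs.squarefree_of_dvd hGi)]
      have : T = (Finset.univ.filter (fun P => f P = i)).map (Function.Embedding.subtype _) := by
        ext P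
        simp only [hT, Finset.mem_map, Finset.mem_filter, Finset.mem_univ, true_and,
          Function.Embedding.coe_subtype]
        constructor
        · rintro ⟨h1, h2, h3⟩
          refine ⟨⟨P, (hS P).2 ⟨h1, h2, h3.trans hGi⟩⟩, ?_, rfl⟩
          by_contra hne
          have hd := hf ⟨P, (hS P).2 ⟨h1, h2, h3.trans hGi⟩⟩
          generalize f ⟨P, (hS P).2 ⟨h1, h2, h3.trans hGi⟩⟩ = j at *
          apply h1.not_isUnit
          apply hs P
          rw [← hG, ← Finset.mul_prod_erase _ _ (Finset.mem_univ i)]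
          refine mul_dvd_mul h3 (hd.trans ?_)
          exact Finset.dvd_prod_of_mem G (by simpa using hne)
        · rintro ⟨P, h, rfl⟩
          have hP := (hS P.1).1 P.2
          exact ⟨hP.1, hP.2.1, h ▸ hf P⟩
      rw [this, Finset.prod_map]
      rfl
    · rintro ⟨f, rfl⟩
      have hmon : ∀ i, (φ f i).Monic := fun i =>
        monic_prod_of_monic _ _ fun P _ => ((hS P.1).1 P.2).2.1
      have hprod : ∏ i, φ f i = H := by
        rw [← hSp, ← Finset.prod_coe_sort S (fun P => P)]
        exact Finset.prod_fiberwise Finset.univ f (fun P : S => P.1)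
      refine ⟨⟨hmon, ?_⟩, hprod⟩
      rw [← natDegree_prod_of_monic _ _ fun i _ => hmon i, hprod, hm]
  rw [himg, Finset.card_image_of_injective _ hinj]
  simp

lemma a_eq (k : ℕ) (ω : Fq[X] → ℕ)
    (hω : ∀ H : Fq[X], ω H = {Q : Fq[X] | Q.Monic ∧ Irreducible Q ∧ Q ∣ H}.ncard) (m : ℕ) :
    ∑ᶠ H ∈ {H : Fq[X] | H.Monic ∧ Squarefree H ∧ H.natDegree = m}, k ^ ω H =
      (sqfTup Fq k m).card := by
  classical
  have e : {H : Fq[X] | H.Monic ∧ Squarefree H ∧ H.natDegree = m} =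
      (((monFin Fq m).filter fun H => Squarefree H : Finset Fq[X]) : Set Fq[X]) := by
    ext H; simp only [Set.mem_ofPred_eq, Finset.coe_filter, mem_monFin]; tauto
  rw [e, finsum_mem_coe_finset]
  rw [Finset.card_eq_sum_card_fiberwise (f := fun G => ∏ i, G i)
    (t := (monFin Fq m).filter fun H => Squarefree H)]
  · refine Finset.sum_congr rfl fun H hH => ?_
    obtain ⟨h1, hs⟩ := Finset.mem_filter.1 hH
    obtain ⟨hm, hd⟩ := mem_monFin.1 h1
    rw [hω, ← card_fact k m H hm hs hd]
    congr 1
    ext G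
    simp only [sqfTup, Finset.mem_filter]
    constructor
    · rintro ⟨h, rfl⟩; exact ⟨⟨h, hs⟩, rfl⟩
    · rintro ⟨⟨h, -⟩, rfl⟩; exact ⟨h, rfl⟩
  · intro G hG
    simp only [sqfTup, Finset.coe_filter, Set.mem_ofPred_eq, mem_tupFin, mem_monFin] at hG ⊢
    refine ⟨⟨monic_prod_of_monic _ _ fun i _ => hG.1.1 i, ?_⟩, hG.2⟩
    rw [natDegree_prod_of_monic _ _ fun i _ => hG.1.1 i, hG.1.2]

end Helpers

lemma lower_partial (q : ℕ) (hq : 2 ≤ q) (d r : ℕ) (a : ℕ → ℕ)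
    (hub : ∀ m, a m ≤ q ^ m * (m + d).choose d)
    (hlb : ∀ m, q ^ m * (m + d).choose d ≤
      ∑ s ∈ Finset.range (m / 2 + 1), a (m - 2 * s) * (q ^ s * (s + r).choose r)) :
    ∃ c : ℝ, 0 < c ∧ ∀ m : ℕ, c * ((q : ℝ) ^ m * ((m : ℝ) + 1) ^ d) ≤
      ∑ n ∈ Finset.range (m + 1), (a n : ℝ) := by
  have hq0 : (0 : ℝ) < q := by positivity
  have hq2 : (2 : ℝ) ≤ q := by exact_mod_cast hq
  have hsum : Summable fun n : ℕ => ((n + r).choose r : ℝ) * ((q : ℝ)⁻¹) ^ n := by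
    apply summable_choose_mul_geometric_of_norm_lt_one
    rw [norm_inv, Real.norm_natCast]
    exact inv_lt_one_of_one_lt₀ (by linarith)
  set w : ℕ → ℝ := fun n => ((n + r).choose r : ℝ) * ((q : ℝ)⁻¹) ^ n with hw
  have hw0 : ∀ n, 0 ≤ w n := fun n => by positivity
  obtain ⟨s₀, hs₀⟩ : ∃ s₀, (∑' n, w n) - 1 / 2 < ∑ n ∈ Finset.range s₀, w n :=
    ((hsum.hasSum.tendsto_sum_nat.eventually_const_lt (by linarith)).exists)
  have htail : ∀ A : Finset ℕ, (∀ s ∈ A, s₀ ≤ s) → ∑ s ∈ A, w s ≤ 1 / 2 := by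
    intro A hA
    have hdis : Disjoint A (Finset.range s₀) := by
      rw [Finset.disjoint_left]
      intro s hs hs'
      have := hA s hs
      rw [Finset.mem_range] at hs'
      omega
    have := hsum.sum_le_tsum (A ∪ Finset.range s₀) (fun i _ => hw0 i)
    rw [Finset.sum_union hdis] at this
    linarith
  set B : ℝ := 1 + ∑ s ∈ Finset.range s₀, (q : ℝ) ^ s * ((s + r).choose r : ℝ) with hB
  have hB1 : 1 ≤ B := by
    have : 0 ≤ ∑ s ∈ Finset.range s₀, (q : ℝ) ^ s * ((s + r).choose r : ℝ) := by positivity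
    linarith
  refine ⟨1 / (2 * B * d.factorial), by positivity, fun m => ?_⟩
  set U : ℝ := (q : ℝ) ^ m * ((m + d).choose d : ℝ) with hU
  have hU0 : 0 ≤ U := by positivity
  set Sm : ℝ := ∑ n ∈ Finset.range (m + 1), (a n : ℝ) with hSm
  have hSm0 : 0 ≤ Sm := by positivity
  have h1 : U ≤ ∑ s ∈ Finset.range (m / 2 + 1),
      (a (m - 2 * s) : ℝ) * ((q : ℝ) ^ s * ((s + r).choose r : ℝ)) := by
    have := hlb m
    rw [hU]; exact_mod_cast this
  rw [← Finset.sum_filter_add_sum_filter_not _ (fun s => s < s₀)] at h1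
  have hhead : ∑ s ∈ (Finset.range (m / 2 + 1)).filter (fun s => s < s₀),
      (a (m - 2 * s) : ℝ) * ((q : ℝ) ^ s * ((s + r).choose r : ℝ)) ≤ Sm * B := by
    have : ∑ s ∈ (Finset.range (m / 2 + 1)).filter (fun s => s < s₀),
      (a (m - 2 * s) : ℝ) * ((q : ℝ) ^ s * ((s + r).choose r : ℝ)) ≤
        ∑ s ∈ Finset.range s₀, Sm * ((q : ℝ) ^ s * ((s + r).choose r : ℝ)) := by
      refine (Finset.sum_le_sum (g := fun s => Sm * ((q : ℝ) ^ s * ((s + r).choose r : ℝ)))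
        fun s _ => ?_).trans (Finset.sum_le_sum_of_subset_of_nonneg ?_ fun s _ _ => by positivity)
      · refine mul_le_mul_of_nonneg_right ?_ (by positivity)
        exact Finset.single_le_sum (f := fun n => (a n : ℝ)) (fun i _ => by positivity)
          (Finset.mem_range.2 (by omega))
      · intro s hs
        rw [Finset.mem_filter] at hs
        exact Finset.mem_range.2 hs.2
    rw [← Finset.mul_sum] at this
    nlinarith
  have htl : ∑ s ∈ (Finset.range (m / 2 + 1)).filter (fun s => ¬ s < s₀),
      (a (m - 2 * s) : ℝ) * ((q : ℝ) ^ s * ((s + r).choose r : ℝ)) ≤ U * (1 / 2) := by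
    refine le_trans ?_ (mul_le_mul_of_nonneg_left
      (htail ((Finset.range (m / 2 + 1)).filter (fun s => ¬ s < s₀)) ?_) hU0)
    · rw [Finset.mul_sum]
      refine Finset.sum_le_sum fun s hs => ?_
      have hs2 : 2 * s ≤ m := by
        have := Finset.mem_range.1 (Finset.mem_filter.1 hs).1
        omega
      have ha : (a (m - 2 * s) : ℝ) ≤ (q : ℝ) ^ (m - 2 * s) * ((m + d).choose d : ℝ) := by
        have h2 := (hub (m - 2 * s)).trans
          (Nat.mul_le_mul_left _ (Nat.choose_le_choose d (show m - 2 * s + d ≤ m + d by omega)))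
        exact_mod_cast h2
      refine (mul_le_mul_of_nonneg_right ha (by positivity)).trans (le_of_eq ?_)
      have hpow : (q : ℝ) ^ m = (q : ℝ) ^ (m - 2 * s) * (q : ℝ) ^ s * (q : ℝ) ^ s := by
        rw [← pow_add, ← pow_add]; congr 1; omega
      rw [hU, hw, hpow]
      simp only [inv_pow]
      field_simp
    · intro s hs
      exact not_lt.1 (Finset.mem_filter.1 hs).2
  have hch : ((m : ℝ) + 1) ^ d ≤ d.factorial * ((m + d).choose d : ℝ) := by
    have := Nat.pow_le_choose (α := ℝ) d (m + d)
    rw [show m + d + 1 - d = m + 1 by omega, div_le_iff₀ (by positivity)] at this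
    push_cast at this
    linarith
  have hmain : U ≤ 2 * B * Sm := by linarith
  rw [div_mul_eq_mul_div, one_mul, div_le_iff₀ (by positivity)]
  calc (q : ℝ) ^ m * ((m : ℝ) + 1) ^ d ≤ (q : ℝ) ^ m * (d.factorial * ((m + d).choose d : ℝ)) := by
        gcongr
    _ = U * d.factorial := by rw [hU]; ring
    _ ≤ (2 * B * Sm) * d.factorial := by gcongr
    _ = Sm * (2 * B * d.factorial) := by ring

lemma upper_partial (q : ℕ) (hq : 2 ≤ q) (d : ℕ) (a : ℕ → ℕ)
    (hub : ∀ m, a m ≤ q ^ m * (m + d).choose d) (m : ℕ) (hm : 1 ≤ m) :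
    ∑ n ∈ Finset.range (m + 1), (a n : ℝ) ≤ (2 * ((d : ℝ) + 1) ^ d) * ((q : ℝ) ^ m * (m : ℝ) ^ d) := by
  have hq2 : (2 : ℝ) ≤ q := by exact_mod_cast hq
  have hgeom : ∀ m : ℕ, ∑ n ∈ Finset.range (m + 1), (q : ℝ) ^ n ≤ 2 * (q : ℝ) ^ m := by
    intro m
    induction m with
    | zero => simp
    | succ m ih =>
      rw [Finset.sum_range_succ, pow_succ]
      have : (0 : ℝ) < (q : ℝ) ^ m := by positivity
      nlinarith
  have h1 : ∀ n ∈ Finset.range (m + 1), (a n : ℝ) ≤ (q : ℝ) ^ n * (((d : ℝ) + 1) ^ d * (m : ℝ) ^ d) := by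
    intro n hn
    have hn := Finset.mem_range.1 hn
    have h2 : (n + d).choose d ≤ ((d + 1) * m) ^ d :=
      (Nat.choose_le_pow _ _).trans (Nat.pow_le_pow_left (by nlinarith) d)
    have h3 := (hub n).trans (Nat.mul_le_mul_left _ h2)
    rw [mul_pow] at h3
    exact_mod_cast h3
  refine (Finset.sum_le_sum h1).trans ?_
  rw [← Finset.sum_mul]
  calc _ ≤ (2 * (q : ℝ) ^ m) * (((d : ℝ) + 1) ^ d * (m : ℝ) ^ d) := by
        gcongr
        exact hgeom m
    _ = _ := by ring

theorem stmt_9 (Fq : Type*) [Field Fq] [Fintype Fq] (k : ℕ) (hk : 1 ≤ k)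
    (ω : Fq[X] → ℕ)
    (hω : ∀ H : Fq[X], ω H = {Q : Fq[X] | Q.Monic ∧ Irreducible Q ∧ Q ∣ H}.ncard)
    (a : ℕ → ℕ)
    (ha : ∀ m : ℕ, a m =
      ∑ᶠ H ∈ {H : Fq[X] | H.Monic ∧ Squarefree H ∧ H.natDegree = m}, k ^ ω H) :
    ∃ c C X₀ : ℝ, 0 < c ∧ c ≤ C ∧ 1 < X₀ ∧
      ∀ X : ℝ, X₀ ≤ X →
        c * X * (Real.log X / Real.log (Fintype.card Fq)) ^ (k - 1)
            ≤ ∑ᶠ m ∈ {m : ℕ | (Fintype.card Fq : ℝ) ^ m ≤ X}, (a m : ℝ) ∧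
        (∑ᶠ m ∈ {m : ℕ | (Fintype.card Fq : ℝ) ^ m ≤ X}, (a m : ℝ))
            ≤ C * X * (Real.log X / Real.log (Fintype.card Fq)) ^ (k - 1) := by
  have ha' : ∀ m, a m = (sqfTup Fq k m).card := fun m => (ha m).trans (a_eq k ω hω m)
  have : Nonempty (Fin k) := ⟨⟨0, hk⟩⟩
  have hT := card_tupFin Fq (Fin k)
  have hT2 := card_tupFin Fq (Fin k × Fin k)
  simp only [Fintype.card_fin, Fintype.card_prod] at hT hT2
  have hub : ∀ m, a m ≤ Fintype.card Fq ^ m * (m + (k - 1)).choose (k - 1) := by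
    intro m
    rw [ha', ← hT]
    classical exact Finset.card_le_card (Finset.filter_subset _ _)
  have hlb : ∀ m, Fintype.card Fq ^ m * (m + (k - 1)).choose (k - 1) ≤
      ∑ s ∈ Finset.range (m / 2 + 1), a (m - 2 * s) *
        (Fintype.card Fq ^ s * (s + (k * k - 1)).choose (k * k - 1)) := by
    intro m
    rw [← hT]
    refine (card_tup_le Fq k m).trans (le_of_eq ?_)
    exact Finset.sum_congr rfl fun s _ => by rw [ha', hT2]
  have hq : 2 ≤ Fintype.card Fq := Fintype.one_lt_card
  generalize Fintype.card Fq = q at *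
  generalize k - 1 = d at *
  obtain ⟨c, hc, hlow⟩ := lower_partial q hq d _ a hub hlb
  have hup := upper_partial q hq d a hub
  have hq2 : (2 : ℝ) ≤ q := by exact_mod_cast hq
  have hq0 : (0 : ℝ) < q := by linarith
  have hlq : 0 < Real.log q := Real.log_pos (by linarith)
  refine ⟨c / q, max (c / q) (2 * ((d : ℝ) + 1) ^ d), q, by positivity, le_max_left _ _,
    by linarith, fun X hX => ?_⟩
  have hX0 : 0 < X := by linarith
  set L := Real.log X / Real.log q with hL
  have hL1 : 1 ≤ L := by
    rw [hL, le_div_iff₀ hlq, one_mul]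
    exact Real.log_le_log hq0 hX
  have hiff : ∀ m : ℕ, (q : ℝ) ^ m ≤ X ↔ (m : ℝ) ≤ L := by
    intro m
    rw [hL, le_div_iff₀ hlq, ← Real.log_pow, Real.log_le_log_iff (by positivity) hX0]
  set M := ⌊L⌋₊ with hM
  have hset : {m : ℕ | (q : ℝ) ^ m ≤ X} = (Finset.range (M + 1) : Finset ℕ) := by
    ext m
    simp only [Set.mem_ofPred_eq, Finset.coe_range, Set.mem_Iio]
    rw [hiff, ← Nat.le_floor_iff (by linarith), Nat.lt_succ_iff]
  rw [hset, finsum_mem_coe_finset]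
  have hM1 : 1 ≤ M := Nat.le_floor (by exact_mod_cast hL1)
  have hML : (M : ℝ) ≤ L := Nat.floor_le (by linarith)
  have hLM : L < M + 1 := Nat.lt_floor_add_one L
  have hqM : (q : ℝ) ^ M ≤ X := (hiff M).2 hML
  have hXq : X ≤ (q : ℝ) ^ M * q := by
    rw [← pow_succ]
    by_contra h
    have := (hiff (M + 1)).1 (not_le.1 h).le
    push_cast at this
    linarith
  constructor
  · refine le_trans ?_ (hlow M)
    calc c / q * X * L ^ d ≤ c / q * ((q : ℝ) ^ M * q) * ((M : ℝ) + 1) ^ d := by gcongr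
      _ = c * ((q : ℝ) ^ M * ((M : ℝ) + 1) ^ d) := by field_simp
  · refine (hup M hM1).trans ?_
    rw [mul_assoc (max _ _)]
    gcongr
    exact le_max_right _ _
end

section
/- Fix a finite field 𝔽_q and a prime p ≥ 3. For a real number s > 1 and a monic irreducible polynomial Q ∈ 𝔽_q[x], define Z_Q(s) = (1 + ∑_{i=0}^{p-3} |Q|^{(i+1)-(i+2)s} - ∑_{i=0}^{p-2} |Q|^{i-(i+2)s}) / (1 - |Q|^{(p-1)-ps}) and ψ_{p,Q}(s) = (1 + ∑_{i=0}^{p-3} |Q|^{(i+1)-(i+2)s} - ∑_{i=0}^{p-2} |Q|^{i-(i+2)s}) · ∏_{i=0}^{p-3} (1 - |Q|^{(i+1)-(i+2)s}). Then for every real s > 1 both families (Z_Q(s))_Q and (ψ_{p,Q}(s))_Q, indexed by monic irreducible polynomials Q, are multipliable, and ∏_Q Z_Q(s) = (∏_Q ψ_{p,Q}(s)) · ∏_{i=0}^{p-2} (1 - q^{(i+2)(1-s)})^{-1}. -/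
open Polynomial Filter Topology

/-- Generating series of the monic polynomials over a finite field. -/
lemma monic_hasSum (Fq : Type*) [Field Fq] [Fintype Fq] (u : ℝ) (hu : 0 ≤ u)
    (hqu : (Fintype.card Fq : ℝ) * u < 1) :
    HasSum (fun f : {f : Fq[X] // f.Monic} => u ^ f.1.natDegree)
      (1 - (Fintype.card Fq : ℝ) * u)⁻¹ := by
  have e : ∀ n : ℕ, {f : {f : Fq[X] // f.Monic} // f.1.natDegree = n} ≃ (Fin n → Fq) := fun n =>
    ((Equiv.subtypeSubtypeEquivSubtypeInter (fun f : Fq[X] => f.Monic)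
      (fun f => f.natDegree = n)).trans (monicEquivDegreeLT n)).trans (degreeLTEquiv Fq n).toEquiv
  have hfib : ∀ n : ℕ, HasSum (fun f : {f : {f : Fq[X] // f.Monic} // f.1.natDegree = n} =>
      u ^ f.1.1.natDegree) (((Fintype.card Fq : ℝ) * u) ^ n) := by
    intro n
    rw [← (e n).symm.hasSum_iff]
    have h : ((fun f : {f : {f : Fq[X] // f.Monic} // f.1.natDegree = n} =>
      u ^ f.1.1.natDegree) ∘ (e n).symm) = fun _ => u ^ n := by
      funext v
      simp only [Function.comp]
      rw [((e n).symm v).2]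
    rw [h]
    convert hasSum_fintype (fun _ : Fin n → Fq => u ^ n) using 1
    simp [mul_pow]
  have hgeo := hasSum_geometric_of_lt_one (r := (Fintype.card Fq : ℝ) * u) (by positivity) hqu
  rw [← (Equiv.sigmaFiberEquiv (fun f : {f : Fq[X] // f.Monic} => f.1.natDegree)).hasSum_iff]
  refine HasSum.sigma_of_hasSum hgeo hfib ?_
  rw [summable_sigma_of_nonneg]
  · refine ⟨fun n => (hfib n).summable, ?_⟩
    refine hgeo.summable.congr ?_
    intro n
    exact (hfib n).tsum_eq.symm
  · intro x
    exact pow_nonneg hu _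

open Classical in
/-- Sieving out finitely many primes. -/
lemma sieve_hasSum (Fq : Type*) [Field Fq] [Fintype Fq] (u : ℝ) (hu : 0 ≤ u)
    (hqu : (Fintype.card Fq : ℝ) * u < 1)
    (S : Finset {Q : Fq[X] // Q.Monic ∧ Irreducible Q}) :
    HasSum (fun f : {f : Fq[X] // f.Monic} =>
      if ∀ Q ∈ S, ¬ Q.1 ∣ f.1 then u ^ f.1.natDegree else 0)
      ((∏ Q ∈ S, (1 - u ^ Q.1.natDegree)) * (1 - (Fintype.card Fq : ℝ) * u)⁻¹) := by
  induction S using Finset.induction_on with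
  | empty => simpa using monic_hasSum Fq u hu hqu
  | insert Q S hQ ih =>
    set A := (∏ Q ∈ S, (1 - u ^ Q.1.natDegree)) * (1 - (Fintype.card Fq : ℝ) * u)⁻¹ with hA
    have hG : HasSum (fun f : {f : Fq[X] // f.Monic} => if Q.1 ∣ f.1 then
        (if ∀ Q ∈ S, ¬ Q.1 ∣ f.1 then u ^ f.1.natDegree else 0) else 0)
        (u ^ Q.1.natDegree * A) := by
      let m : {f : Fq[X] // f.Monic} → {f : Fq[X] // f.Monic} :=
        fun g => ⟨Q.1 * g.1, Q.2.1.mul g.2⟩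
      have hm : Function.Injective m := by
        intro a b hab
        have h := congrArg Subtype.val hab
        exact Subtype.ext (mul_left_cancel₀ Q.2.1.ne_zero h)
      rw [← hm.hasSum_iff]
      · have h2 := ih.mul_left (u ^ Q.1.natDegree)
        refine h2.congr_fun ?_
        intro g
        have hiff : (∀ P ∈ S, ¬ P.1 ∣ Q.1 * g.1) ↔ (∀ P ∈ S, ¬ P.1 ∣ g.1) := by
          refine forall₂_congr fun P hP => not_congr ⟨fun h => ?_, fun h => h.mul_left _⟩
          rcases P.2.2.prime.dvd_or_dvd h with h | h
          · exfalso
            apply hQ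
            have : P = Q := Subtype.ext (Polynomial.eq_of_monic_of_associated P.2.1 Q.2.1
              (P.2.2.associated_of_dvd Q.2.2 h))
            exact this ▸ hP
          · exact h
        simp only [Function.comp, m, dvd_mul_right, if_true, hiff, Q.2.1.natDegree_mul g.2, pow_add]
        split_ifs <;> simp
      · intro f hf
        rw [if_neg]
        rintro ⟨g, hg⟩
        apply hf
        refine ⟨⟨g, ?_⟩, Subtype.ext hg.symm⟩
        exact Q.2.1.of_mul_monic_left (hg ▸ f.2)
    have h3 := ih.sub hG
    rw [Finset.prod_insert hQ]
    have h4 : (1 - u ^ Q.1.natDegree) * (∏ Q ∈ S, (1 - u ^ Q.1.natDegree)) *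
        (1 - (Fintype.card Fq : ℝ) * u)⁻¹ = A - u ^ Q.1.natDegree * A := by
      rw [hA]; ring
    rw [h4]
    refine h3.congr_fun ?_
    intro f
    simp only [Finset.forall_mem_insert]
    by_cases h : Q.1 ∣ f.1 <;> simp [h]

open Classical in
/-- Euler product for the zeta function of the affine line. -/
lemma euler_hasProd (Fq : Type*) [Field Fq] [Fintype Fq] (u : ℝ) (hu : 0 ≤ u)
    (hqu : (Fintype.card Fq : ℝ) * u < 1) :
    HasProd (fun Q : {Q : Fq[X] // Q.Monic ∧ Irreducible Q} => (1 - u ^ Q.1.natDegree))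
      (1 - (Fintype.card Fq : ℝ) * u) := by
  have hne : (1 - (Fintype.card Fq : ℝ) * u) ≠ 0 := by linarith
  have key : Tendsto (fun S : Finset {Q : Fq[X] // Q.Monic ∧ Irreducible Q} =>
      ∑' f : {f : Fq[X] // f.Monic}, if ∀ Q ∈ S, ¬ Q.1 ∣ f.1 then u ^ f.1.natDegree else 0) atTop
      (𝓝 (∑' f : {f : Fq[X] // f.Monic}, if f.1 = 1 then (1:ℝ) else 0)) := by
    refine tendsto_tsum_of_dominated_convergence (monic_hasSum Fq u hu hqu).summable ?_ ?_
    · intro f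
      by_cases hf : f.1 = 1
      · have : ∀ S : Finset {Q : Fq[X] // Q.Monic ∧ Irreducible Q}, ∀ Q ∈ S, ¬ Q.1 ∣ f.1 := by
          intro S Q _ h
          rw [hf] at h
          exact Q.2.2.not_isUnit (isUnit_of_dvd_one h)
        simp only [if_pos (this _), if_pos hf]
        simp [hf]
      · have hnu : ¬ IsUnit f.1 := fun h => hf (f.2.eq_one_of_isUnit h)
        obtain ⟨Q, hQm, hQi, hQd⟩ := Polynomial.exists_monic_irreducible_factor f.1 hnu
        simp only [hf, if_false]
        refine tendsto_const_nhds.congr' ?_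
        filter_upwards [eventually_ge_atTop {(⟨Q, hQm, hQi⟩ : {Q : Fq[X] // Q.Monic ∧ Irreducible Q})}] with S hS
        rw [if_neg]
        intro h
        exact h ⟨Q, hQm, hQi⟩ (hS (Finset.mem_singleton_self _)) hQd
    · refine Eventually.of_forall fun S f => ?_
      split_ifs
      · rw [Real.norm_of_nonneg (pow_nonneg hu _)]
      · simpa using pow_nonneg hu _
  have h1 : (∑' f : {f : Fq[X] // f.Monic}, if f.1 = 1 then (1:ℝ) else 0) = 1 := by
    rw [tsum_eq_single ⟨1, monic_one⟩]
    · simp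
    · intro f hf
      rw [if_neg]
      exact fun h => hf (Subtype.ext h)
  rw [h1] at key
  have key2 := key.mul_const (1 - (Fintype.card Fq : ℝ) * u)
  rw [one_mul] at key2
  show Tendsto _ _ _
  rw [SummationFilter.unconditional_filter]
  refine key2.congr fun S => ?_
  rw [(sieve_hasSum Fq u hu hqu S).tsum_eq, mul_assoc, inv_mul_cancel₀ hne, mul_one]



/-- Over a finite field `𝔽_q` with `p ≥ 3` a prime: for every real `s > 1`, the families
`Z_Q(s)` and `ψ_{p,Q}(s)` (indexed by monic irreducible `Q ∈ 𝔽_q[x]`) are multipliable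
and `∏_Q Z_Q(s) = (∏_Q ψ_{p,Q}(s)) · ∏_{i=0}^{p-2} (1 - q^{(i+2)(1-s)})⁻¹`. -/
theorem stmt_12 (Fq : Type*) [Field Fq] [Fintype Fq] (p : ℕ) (hp : p.Prime) (hp3 : 3 ≤ p)
    (N Z ψ : {Q : Fq[X] // Q.Monic ∧ Irreducible Q} → ℝ → ℝ)
    (hN : ∀ Q s, N Q s =
      1 + (∑ i ∈ Finset.range (p - 2),
            ((Fintype.card Fq : ℝ) ^ Q.1.natDegree) ^ (((i : ℝ) + 1) - ((i : ℝ) + 2) * s))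
        - ∑ i ∈ Finset.range (p - 1),
            ((Fintype.card Fq : ℝ) ^ Q.1.natDegree) ^ ((i : ℝ) - ((i : ℝ) + 2) * s))
    (hZ : ∀ Q s, Z Q s =
      N Q s / (1 - ((Fintype.card Fq : ℝ) ^ Q.1.natDegree) ^ (((p : ℝ) - 1) - (p : ℝ) * s)))
    (hψ : ∀ Q s, ψ Q s =
      N Q s * ∏ i ∈ Finset.range (p - 2),
        (1 - ((Fintype.card Fq : ℝ) ^ Q.1.natDegree) ^ (((i : ℝ) + 1) - ((i : ℝ) + 2) * s))) :
    ∀ s : ℝ, 1 < s →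
      Multipliable (fun Q => Z Q s) ∧
      Multipliable (fun Q => ψ Q s) ∧
      (∏' Q : {Q : Fq[X] // Q.Monic ∧ Irreducible Q}, Z Q s)
        = (∏' Q : {Q : Fq[X] // Q.Monic ∧ Irreducible Q}, ψ Q s) *
            ∏ i ∈ Finset.range (p - 1),
              (1 - (Fintype.card Fq : ℝ) ^ (((i : ℝ) + 2) * (1 - s)))⁻¹ := by
  intro s hs
  set q : ℝ := (Fintype.card Fq : ℝ) with hq
  have hq1 : 1 < q := by
    rw [hq]; exact_mod_cast Fintype.one_lt_card (α := Fq)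
  have hq0 : 0 < q := by linarith
  have hpow : ∀ (Q : {Q : Fq[X] // Q.Monic ∧ Irreducible Q}) (x : ℝ),
      (q ^ Q.1.natDegree) ^ x = (q ^ x) ^ Q.1.natDegree := by
    intro Q x
    rw [← Real.rpow_natCast, ← Real.rpow_natCast, ← Real.rpow_mul hq0.le, ← Real.rpow_mul hq0.le,
      mul_comm]
  have hlt : ∀ x : ℝ, x < -1 → q * q ^ x < 1 := by
    intro x hx
    have : q * q ^ x = q ^ (1 + x) := by rw [Real.rpow_add hq0, Real.rpow_one]
    rw [this]
    exact Real.rpow_lt_one_of_one_lt_of_neg hq1 (by linarith)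
  have hE : ∀ x : ℝ, x < -1 → HasProd (fun Q : {Q : Fq[X] // Q.Monic ∧ Irreducible Q} =>
      1 - (q ^ Q.1.natDegree) ^ x) (1 - q * q ^ x) := by
    intro x hx
    simp only [hpow]
    exact euler_hasProd Fq (q ^ x) (by positivity) (hlt x hx)
  have hS : ∀ x : ℝ, x < -1 → Summable (fun Q : {Q : Fq[X] // Q.Monic ∧ Irreducible Q} =>
      (q ^ Q.1.natDegree) ^ x) := by
    intro x hx
    simp only [hpow]
    have h := (monic_hasSum Fq (q ^ x) (by positivity) (hlt x hx)).summable
    exact h.comp_injective (i := fun Q : {Q : Fq[X] // Q.Monic ∧ Irreducible Q} =>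
      (⟨Q.1, Q.2.1⟩ : {f : Fq[X] // f.Monic})) (fun a b hab => Subtype.ext (congrArg (fun z => z.1) hab))
  have hx1 : ∀ i : ℕ, ((i : ℝ) + 1) - ((i : ℝ) + 2) * s < -1 := by
    intro i
    have : (0 : ℝ) ≤ i := Nat.cast_nonneg i
    nlinarith
  have hx2 : ∀ i : ℕ, (i : ℝ) - ((i : ℝ) + 2) * s < -1 := by
    intro i
    linarith [hx1 i]
  have hNm : Multipliable (fun Q => N Q s) := by
    have h := (summable_sum (s := Finset.range (p - 2)) (fun i _ => hS _ (hx1 i))).sub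
      (summable_sum (s := Finset.range (p - 1)) (fun i _ => hS _ (hx2 i)))
    refine (Real.multipliable_one_add_of_summable h).congr ?_
    intro Q
    rw [hN]; ring
  have hψm : Multipliable (fun Q => ψ Q s) := by
    simp only [hψ]
    exact hNm.mul (multipliable_prod (fun i _ => (hE _ (hx1 i)).multipliable))
  have hInv : ∀ i : ℕ, HasProd (fun Q : {Q : Fq[X] // Q.Monic ∧ Irreducible Q} =>
      (1 - (q ^ Q.1.natDegree) ^ (((i : ℝ) + 1) - ((i : ℝ) + 2) * s))⁻¹)
      (1 - q ^ (((i : ℝ) + 2) * (1 - s)))⁻¹ := by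
    intro i
    have h := hE _ (hx1 i)
    have he : q ^ (((i : ℝ) + 2) * (1 - s)) = q * q ^ (((i : ℝ) + 1) - ((i : ℝ) + 2) * s) := by
      conv_rhs => rw [← Real.rpow_one_add' hq0.le (by linarith [hx1 i])]
      congr 1; ring
    rw [he]
    have hne : 1 - q * q ^ (((i : ℝ) + 1) - ((i : ℝ) + 2) * s) ≠ 0 := by
      linarith [hlt _ (hx1 i)]
    have h2 := Tendsto.inv₀ h hne
    refine Tendsto.congr (fun S => ?_) h2
    exact (Finset.prod_inv_distrib _).symm
  have hInvP := hasProd_prod (s := Finset.range (p - 1)) (fun i _ => hInv i)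
  have hZeq : ∀ Q, Z Q s = ψ Q s * ∏ i ∈ Finset.range (p - 1),
      (1 - (q ^ Q.1.natDegree) ^ (((i : ℝ) + 1) - ((i : ℝ) + 2) * s))⁻¹ := by
    intro Q
    obtain ⟨k, rfl⟩ : ∃ k, p = k + 2 := ⟨p - 2, by omega⟩
    have hne : ∀ i : ℕ, 1 - (q ^ Q.1.natDegree) ^ (((i : ℝ) + 1) - ((i : ℝ) + 2) * s) ≠ 0 := by
      intro i
      have : (q ^ Q.1.natDegree) ^ (((i : ℝ) + 1) - ((i : ℝ) + 2) * s) < 1 :=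
        Real.rpow_lt_one_of_one_lt_of_neg (one_lt_pow₀ hq1 Q.2.2.natDegree_pos.ne')
          (by linarith [hx1 i])
      linarith
    rw [hZ, hψ]
    have e1 : k + 2 - 2 = k := by omega
    have e2 : k + 2 - 1 = k + 1 := by omega
    rw [e1, e2, Finset.prod_range_succ, Finset.prod_inv_distrib]
    have hP : ∏ i ∈ Finset.range k,
      (1 - (q ^ Q.1.natDegree) ^ (((i : ℝ) + 1) - ((i : ℝ) + 2) * s)) ≠ 0 :=
      Finset.prod_ne_zero_iff.mpr fun i _ => hne i
    have e3 : (((k + 2 : ℕ) : ℝ) - 1) - ((k + 2 : ℕ) : ℝ) * s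
        = ((k : ℝ) + 1) - ((k : ℝ) + 2) * s := by push_cast; ring
    rw [e3, div_eq_mul_inv, mul_assoc, mul_inv_cancel_left₀ hP]
  have hfin := hψm.hasProd.mul hInvP
  simp only [← hZeq] at hfin
  exact ⟨hfin.multipliable, hψm, hfin.tprod_eq⟩
end

section
/- Fix a finite field 𝔽_q. For every real number s > 1, the family (1 + (|Q|-1)·|Q|^{-2s}), indexed by monic irreducible polynomials Q ∈ 𝔽_q[x], is multipliable; the family (1 - |Q|^{-2s} - |Q|^{2-4s} + |Q|^{1-4s}) is also multipliable; and ∏_Q (1 + (|Q|-1)·|Q|^{-2s}) = (1 - q^{2-2s})^{-1} · ∏_Q (1 - |Q|^{-2s} - |Q|^{2-4s} + |Q|^{1-4s}). -/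
open Polynomial

open Classical in
/-- sieved summand: monic polynomials not divisible by any member of `S` -/
noncomputable def sieveTerm {F : Type*} [Field F] (u : ℝ)
    (S : Finset {Q : F[X] // Q.Monic ∧ Irreducible Q}) (f : F[X]) : ℝ :=
  if f.Monic ∧ ∀ Q ∈ S, ¬ Q.1 ∣ f then u ^ f.natDegree else 0

lemma hasSum_monic {F : Type*} [Field F] [Fintype F] {u : ℝ} (hu0 : 0 ≤ u)
    (hu1 : (Fintype.card F : ℝ) * u < 1) :
    HasSum (fun f : {f : F[X] // f.Monic} => u ^ f.1.natDegree)
      (1 - (Fintype.card F : ℝ) * u)⁻¹ := by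
  let e : (Σ n : ℕ, {p : F[X] // p.Monic ∧ p.natDegree = n}) ≃ {f : F[X] // f.Monic} :=
    { toFun := fun x => ⟨x.2.1, x.2.2.1⟩
      invFun := fun f => ⟨f.1.natDegree, f.1, f.2, rfl⟩
      left_inv := by rintro ⟨n, p, h, rfl⟩; rfl
      right_inv := fun f => rfl }
  have key : ∀ n : ℕ, HasSum (fun p : {p : F[X] // p.Monic ∧ p.natDegree = n} =>
      u ^ p.1.natDegree) (((Fintype.card F : ℝ) * u) ^ n) := by
    intro n
    let e2 : {p : F[X] // p.Monic ∧ p.natDegree = n} ≃ (Fin n → F) :=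
      (monicEquivDegreeLT n).trans (degreeLTEquiv F n).toEquiv
    let _ : Fintype {p : F[X] // p.Monic ∧ p.natDegree = n} := Fintype.ofEquiv _ e2.symm
    have h := hasSum_fintype (fun p : {p : F[X] // p.Monic ∧ p.natDegree = n} =>
      u ^ p.1.natDegree)
    convert h using 1
    rw [Finset.sum_congr rfl (fun p _ => by rw [p.2.2])]
    rw [Finset.sum_const, Finset.card_univ, Fintype.card_congr e2]
    simp [mul_pow]
  have hg := hasSum_geometric_of_lt_one (by positivity) hu1
  rw [← e.hasSum_iff]
  have hs : Summable ((fun f : {f : F[X] // f.Monic} => u ^ f.1.natDegree) ∘ e) := by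
    rw [summable_sigma_of_nonneg (fun x => by simp only [Function.comp]; positivity)]
    refine ⟨fun n => (key n).summable, ?_⟩
    refine hg.summable.congr fun n => ?_
    exact ((key n).tsum_eq).symm
  have h2 := hs.hasSum.sigma key
  rw [← h2.unique hg]
  exact hs.hasSum

lemma hasSum_sieve_empty {F : Type*} [Field F] [Fintype F] {u : ℝ} (hu0 : 0 ≤ u)
    (hu1 : (Fintype.card F : ℝ) * u < 1) :
    HasSum (sieveTerm (F := F) u ∅) (1 - (Fintype.card F : ℝ) * u)⁻¹ := by
  have h := hasSum_monic (F := F) hu0 hu1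
  have h2 := (hasSum_subtype_iff_indicator (s := {f : F[X] | f.Monic})
    (f := fun f : F[X] => u ^ f.natDegree)).1 h
  convert h2 using 1
  funext f
  by_cases hf : f.Monic <;> simp [sieveTerm, Set.indicator, hf]

lemma sieveTerm_nonneg {F : Type*} [Field F] {u : ℝ} (hu0 : 0 ≤ u)
    (S : Finset {Q : F[X] // Q.Monic ∧ Irreducible Q}) (f : F[X]) : 0 ≤ sieveTerm u S f := by
  unfold sieveTerm; split_ifs <;> positivity

lemma sieveTerm_le {F : Type*} [Field F] {u : ℝ} (hu0 : 0 ≤ u)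
    (S : Finset {Q : F[X] // Q.Monic ∧ Irreducible Q}) (f : F[X]) :
    sieveTerm u S f ≤ sieveTerm u ∅ f := by
  by_cases h : f.Monic ∧ ∀ Q ∈ S, ¬ Q.1 ∣ f
  · rw [sieveTerm, if_pos h, sieveTerm, if_pos ⟨h.1, by simp⟩]
  · rw [sieveTerm, if_neg h]; exact sieveTerm_nonneg hu0 _ _

open Classical in
lemma hasSum_sieve {F : Type*} [Field F] [Fintype F] {u : ℝ} (hu0 : 0 ≤ u)
    (hu1 : (Fintype.card F : ℝ) * u < 1) (S : Finset {Q : F[X] // Q.Monic ∧ Irreducible Q}) :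
    HasSum (sieveTerm u S)
      ((∏ Q ∈ S, (1 - u ^ Q.1.natDegree)) * (1 - (Fintype.card F : ℝ) * u)⁻¹) := by
  induction S using Finset.induction_on with
  | empty => simpa using hasSum_sieve_empty hu0 hu1
  | insert Q S hQ ih =>
    have hinj : Function.Injective (fun h : F[X] => Q.1 * h) :=
      mul_right_injective₀ Q.2.2.ne_zero
    have hd : HasSum (fun f : F[X] => if Q.1 ∣ f then sieveTerm u S f else 0)
        (u ^ Q.1.natDegree *
          ((∏ Q ∈ S, (1 - u ^ Q.1.natDegree)) * (1 - (Fintype.card F : ℝ) * u)⁻¹)) := by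
      rw [← hinj.hasSum_iff]
      · refine Eq.mpr (congrArg (fun φ => HasSum φ _) (funext fun h => ?_))
          (ih.mul_left (u ^ Q.1.natDegree))
        have hdv : ∀ R ∈ S, (R.1 ∣ Q.1 * h ↔ R.1 ∣ h) := by
          intro R hR
          refine ⟨fun hh => ?_, fun hh => hh.mul_left _⟩
          rcases (R.2.2.prime.dvd_or_dvd hh) with h1 | h1
          · exfalso
            have := eq_of_monic_of_associated R.2.1 Q.2.1
              ((R.2.2.dvd_irreducible_iff_associated Q.2.2).1 h1)
            exact hQ (Subtype.ext this ▸ hR)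
          · exact h1
        have hm : (Q.1 * h).Monic ↔ h.Monic :=
          ⟨fun hh => Q.2.1.of_mul_monic_left hh, fun hh => Q.2.1.mul hh⟩
        have hc : ((Q.1 * h).Monic ∧ ∀ R ∈ S, ¬ R.1 ∣ Q.1 * h) ↔
            (h.Monic ∧ ∀ R ∈ S, ¬ R.1 ∣ h) :=
          and_congr hm (forall₂_congr fun R hR => not_congr (hdv R hR))
        simp only [Function.comp, dvd_mul_right, if_true, sieveTerm]
        by_cases hh : h.Monic ∧ ∀ R ∈ S, ¬ R.1 ∣ h
        · rw [if_pos (hc.2 hh), if_pos hh, Q.2.1.natDegree_mul hh.1, pow_add]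
        · rw [if_neg (fun t => hh (hc.1 t)), if_neg hh, mul_zero]
      · intro f hf
        rw [if_neg]
        rintro ⟨h, rfl⟩
        exact hf ⟨h, rfl⟩
    have hv : (∏ R ∈ insert Q S, (1 - u ^ R.1.natDegree)) * (1 - (Fintype.card F : ℝ) * u)⁻¹ =
        (∏ R ∈ S, (1 - u ^ R.1.natDegree)) * (1 - (Fintype.card F : ℝ) * u)⁻¹ -
        u ^ Q.1.natDegree *
          ((∏ R ∈ S, (1 - u ^ R.1.natDegree)) * (1 - (Fintype.card F : ℝ) * u)⁻¹) := by
      rw [Finset.prod_insert hQ]; ring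
    rw [hv]
    refine Eq.mpr (congrArg (fun φ => HasSum φ _) (funext fun f => ?_)) (ih.sub hd)
    by_cases h : Q.1 ∣ f
    · rw [if_pos h, sub_self, sieveTerm, if_neg]
      exact fun hh => hh.2 Q (Finset.mem_insert_self _ _) h
    · rw [if_neg h, sub_zero, sieveTerm, sieveTerm]
      refine if_congr (and_congr Iff.rfl ?_) rfl rfl
      rw [Finset.forall_mem_insert]
      exact and_iff_right h

lemma hasProd_zeta_inv {F : Type*} [Field F] [Fintype F] {u : ℝ} (hu0 : 0 ≤ u)
    (hu1 : (Fintype.card F : ℝ) * u < 1) :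
    HasProd (fun Q : {Q : F[X] // Q.Monic ∧ Irreducible Q} => 1 - u ^ Q.1.natDegree)
      (1 - (Fintype.card F : ℝ) * u) := by
  classical
  have hpos : 0 < 1 - (Fintype.card F : ℝ) * u := by linarith
  have hlim : Filter.Tendsto (fun S => ∑' f : F[X], sieveTerm u S f) Filter.atTop
      (nhds (∑' f : F[X], if f = 1 then (1 : ℝ) else 0)) := by
    refine tendsto_tsum_of_dominated_convergence (hasSum_sieve_empty hu0 hu1).summable ?_ ?_
    · intro f
      refine tendsto_const_nhds.congr' ?_
      by_cases hf : f = 1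
      · subst hf
        refine Filter.Eventually.of_forall fun S => ?_
        have : ∀ Q ∈ S, ¬ Q.1 ∣ (1 : F[X]) := fun Q _ h =>
          Q.2.2.not_isUnit (isUnit_of_dvd_one h)
        simp only [sieveTerm, if_true]
        rw [if_pos ⟨monic_one, this⟩]; simp
      · simp only [hf, if_false]
        by_cases hm : f.Monic
        · obtain ⟨p, hp, hi, hpd⟩ := exists_monic_irreducible_factor f
            (fun h => hf (hm.isUnit_iff.1 h))
          filter_upwards [Filter.eventually_ge_atTop ({⟨p, hp, hi⟩} : Finset {Q : F[X] // Q.Monic ∧ Irreducible Q})] with S hS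
          rw [sieveTerm, if_neg]
          rintro ⟨_, h⟩
          exact h _ (hS (Finset.mem_singleton_self _)) hpd
        · exact Filter.Eventually.of_forall fun S => by simp [sieveTerm, hm]
    · refine Filter.Eventually.of_forall fun S f => ?_
      rw [Real.norm_of_nonneg (sieveTerm_nonneg hu0 _ _)]
      exact sieveTerm_le hu0 _ _
  rw [tsum_ite_eq] at hlim
  have h2 := hlim.mul_const (1 - (Fintype.card F : ℝ) * u)
  rw [one_mul] at h2
  refine h2.congr fun S => ?_
  rw [(hasSum_sieve hu0 hu1 S).tsum_eq, inv_mul_cancel_right₀ (ne_of_gt hpos)]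


/-- Over a finite field `𝔽_q`, for every real `s > 1`: the families
`(1 + (|Q|-1)·|Q|^{-2s})` and `(1 - |Q|^{-2s} - |Q|^{2-4s} + |Q|^{1-4s})`, indexed by
monic irreducible `Q ∈ 𝔽_q[x]`, are multipliable, and
`∏_Q (1 + (|Q|-1)·|Q|^{-2s}) = (1 - q^{2-2s})⁻¹ · ∏_Q (1 - |Q|^{-2s} - |Q|^{2-4s} + |Q|^{1-4s})`. -/
theorem stmt_14 (Fq : Type*) [Field Fq] [Fintype Fq] (s : ℝ) (hs : 1 < s) :
    Multipliable (fun Q : {Q : Fq[X] // Q.Monic ∧ Irreducible Q} =>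
      1 + (((Fintype.card Fq : ℝ) ^ Q.1.natDegree) - 1) *
        ((Fintype.card Fq : ℝ) ^ Q.1.natDegree) ^ (-(2 * s))) ∧
    Multipliable (fun Q : {Q : Fq[X] // Q.Monic ∧ Irreducible Q} =>
      1 - ((Fintype.card Fq : ℝ) ^ Q.1.natDegree) ^ (-(2 * s))
        - ((Fintype.card Fq : ℝ) ^ Q.1.natDegree) ^ (2 - 4 * s)
        + ((Fintype.card Fq : ℝ) ^ Q.1.natDegree) ^ (1 - 4 * s)) ∧
    (∏' Q : {Q : Fq[X] // Q.Monic ∧ Irreducible Q},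
        (1 + (((Fintype.card Fq : ℝ) ^ Q.1.natDegree) - 1) *
          ((Fintype.card Fq : ℝ) ^ Q.1.natDegree) ^ (-(2 * s))))
      = (1 - (Fintype.card Fq : ℝ) ^ (2 - 2 * s))⁻¹ *
          ∏' Q : {Q : Fq[X] // Q.Monic ∧ Irreducible Q},
            (1 - ((Fintype.card Fq : ℝ) ^ Q.1.natDegree) ^ (-(2 * s))
              - ((Fintype.card Fq : ℝ) ^ Q.1.natDegree) ^ (2 - 4 * s)
              + ((Fintype.card Fq : ℝ) ^ Q.1.natDegree) ^ (1 - 4 * s)) := by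
  have hq1 : (1 : ℝ) < Fintype.card Fq := by exact_mod_cast Fintype.one_lt_card
  have hq0 : (0 : ℝ) < Fintype.card Fq := by linarith
  set q : ℝ := (Fintype.card Fq : ℝ) with hq
  have hu0 : 0 ≤ q ^ (1 - 2 * s) := by positivity
  have hqu : q * q ^ (1 - 2 * s) = q ^ (2 - 2 * s) := by
    rw [show (2 - 2 * s) = 1 + (1 - 2 * s) by ring, Real.rpow_add hq0, Real.rpow_one]
  have hu1 : q * q ^ (1 - 2 * s) < 1 := by
    rw [hqu]; exact Real.rpow_lt_one_of_one_lt_of_neg hq1 (by linarith)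
  have hpow : ∀ n : ℕ, (q ^ (1 - 2 * s)) ^ n = (q ^ n) ^ (1 - 2 * s) := by
    intro n
    rw [← Real.rpow_natCast, ← Real.rpow_natCast, ← Real.rpow_mul hq0.le,
      ← Real.rpow_mul hq0.le, mul_comm]
  have hP := hasProd_zeta_inv (F := Fq) hu0 hu1
  have hsum : Summable (fun Q : {Q : Fq[X] // Q.Monic ∧ Irreducible Q} =>
      (q ^ (1 - 2 * s)) ^ Q.1.natDegree) :=
    (hasSum_monic (F := Fq) hu0 hu1).summable.comp_injective
      (i := fun Q : {Q : Fq[X] // Q.Monic ∧ Irreducible Q} =>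
        (⟨Q.1, Q.2.1⟩ : {f : Fq[X] // f.Monic}))
      (fun a b h => Subtype.ext (congrArg (fun x : {f : Fq[X] // f.Monic} => x.1) h))
  have hA : Multipliable (fun Q : {Q : Fq[X] // Q.Monic ∧ Irreducible Q} =>
      1 + ((q ^ Q.1.natDegree) - 1) * (q ^ Q.1.natDegree) ^ (-(2 * s))) := by
    refine Real.multipliable_one_add_of_summable
      (Summable.of_nonneg_of_le (fun Q => ?_) (fun Q => ?_) hsum)
    · have : 1 ≤ q ^ Q.1.natDegree := one_le_pow₀ hq1.le
      exact mul_nonneg (by linarith) (by positivity)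
    · have hx : 0 < q ^ Q.1.natDegree := by positivity
      have h0 : 0 ≤ (q ^ Q.1.natDegree) ^ (-(2 * s)) := by positivity
      rw [hpow, show (1 - 2 * s) = 1 + (-(2 * s)) by ring, Real.rpow_add hx, Real.rpow_one]
      linarith
  have hB := hA.hasProd.mul hP
  have hfun : (fun Q : {Q : Fq[X] // Q.Monic ∧ Irreducible Q} =>
      (1 + ((q ^ Q.1.natDegree) - 1) * (q ^ Q.1.natDegree) ^ (-(2 * s))) *
        (1 - (q ^ (1 - 2 * s)) ^ Q.1.natDegree)) =
      (fun Q : {Q : Fq[X] // Q.Monic ∧ Irreducible Q} =>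
        1 - (q ^ Q.1.natDegree) ^ (-(2 * s)) - (q ^ Q.1.natDegree) ^ (2 - 4 * s)
        + (q ^ Q.1.natDegree) ^ (1 - 4 * s)) := by
    ext Q
    have hx : 0 < q ^ Q.1.natDegree := by positivity
    rw [hpow]
    generalize q ^ Q.1.natDegree = x at hx
    have e1 : x ^ (1 - 2 * s) = x * x ^ (-(2 * s)) := by
      rw [show (1 - 2 * s) = 1 + (-(2 * s)) by ring, Real.rpow_add hx, Real.rpow_one]
    have e2 : x ^ (1 - 4 * s) = x * (x ^ (-(2 * s)) * x ^ (-(2 * s))) := by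
      rw [show (1 - 4 * s) = 1 + (-(2 * s) + -(2 * s)) by ring, Real.rpow_add hx,
        Real.rpow_add hx, Real.rpow_one]
    have e3 : x ^ (2 - 4 * s) = x * x * (x ^ (-(2 * s)) * x ^ (-(2 * s))) := by
      rw [show (2 - 4 * s) = 1 + 1 + (-(2 * s) + -(2 * s)) by ring, Real.rpow_add hx,
        Real.rpow_add hx, Real.rpow_add hx, Real.rpow_one]
    rw [e1, e2, e3]; ring
  rw [hfun] at hB
  refine ⟨hA, hB.multipliable, ?_⟩
  rw [hB.tprod_eq, ← hqu, ← hq]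
  have hne : 1 - q * q ^ (1 - 2 * s) ≠ 0 := by linarith
  rw [mul_comm _ (1 - q * q ^ (1 - 2 * s)), inv_mul_cancel_left₀ hne]
end

section
/- Fix a finite field 𝔽_q. As s → 1 from the right, (s-1) · ∏_Q (1 + (|Q|-1)·|Q|^{-2s}) tends to Φ/(2·log q), where Φ = ∏_Q (1 - 2·|Q|^{-2} + |Q|^{-3}) is a positive real number (the product being over all monic irreducible polynomials Q ∈ 𝔽_q[x], and convergent) and log denotes the natural logarithm. In particular, the Dirichlet series Z_0(s) = ∏_Q (1 + (|Q|-1)·|Q|^{-2s}) counting ordinary Artin–Schreier covers in characteristic 2 has a simple pole at s = 1. -/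
open Polynomial Filter Topology

lemma aux_hasSum (Fq : Type*) [Field Fq] [Fintype Fq] [DecidablePred (Monic : Fq[X] → Prop)]
    {t : ℝ} (ht : 0 < t) (hqt : Fintype.card Fq * t < 1) :
    HasSum (fun f : Fq[X] => if f.Monic then t ^ f.natDegree else 0)
      (1 - Fintype.card Fq * t)⁻¹ := by
  have hg : HasSum (fun n : ℕ => (Fintype.card Fq * t) ^ n) (1 - Fintype.card Fq * t)⁻¹ :=
    hasSum_geometric_of_lt_one (by positivity) hqt
  let e : (Σ n : ℕ, (Fin n → Fq)) ≃ {f : Fq[X] // f.Monic} :=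
    { toFun := fun x => ⟨(((monicEquivDegreeLT x.1).trans (degreeLTEquiv Fq x.1).toEquiv).symm x.2).1,
        (((monicEquivDegreeLT x.1).trans (degreeLTEquiv Fq x.1).toEquiv).symm x.2).2.1⟩
      invFun := fun f => ⟨f.1.natDegree,
        ((monicEquivDegreeLT f.1.natDegree).trans (degreeLTEquiv Fq f.1.natDegree).toEquiv) ⟨f.1, f.2, rfl⟩⟩
      left_inv := by
        rintro ⟨n, v⟩
        obtain ⟨⟨f, hf, rfl⟩, rfl⟩ :=
          ((monicEquivDegreeLT n).trans (degreeLTEquiv Fq n).toEquiv).surjective v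
        dsimp only
        generalize hg : ((monicEquivDegreeLT f.natDegree).trans
          (degreeLTEquiv Fq f.natDegree).toEquiv).symm _ = g
        rw [Equiv.symm_apply_apply] at hg
        subst hg
        rfl
      right_inv := by
        rintro ⟨f, hf⟩
        simp only [Equiv.symm_apply_apply] }
  have hdeg : ∀ x, (e x).1.natDegree = x.1 := fun x =>
    (((monicEquivDegreeLT x.1).trans (degreeLTEquiv Fq x.1).toEquiv).symm x.2).2.2
  have hin : Function.Injective (fun x => (e x).1) :=
    Subtype.val_injective.comp e.injective
  rw [← hin.hasSum_iff]
  · have h1 : ((fun f : Fq[X] => if f.Monic then t ^ f.natDegree else 0) ∘ fun x => (e x).1)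
        = fun x => t ^ x.1 := by
      funext x
      simp [(e x).2, hdeg]
    rw [h1]
    have hfib : ∀ n : ℕ, ∑' _ : (Fin n → Fq), t ^ n = (Fintype.card Fq * t) ^ n := by
      intro n
      rw [tsum_fintype]
      simp [mul_pow]
    have hs : Summable (fun x : (Σ n : ℕ, (Fin n → Fq)) => t ^ x.1) := by
      rw [summable_sigma_of_nonneg (fun x => by positivity)]
      refine ⟨fun n => (hasSum_fintype _).summable, ?_⟩
      simp only [hfib]
      exact hg.summable
    have := hs.tsum_sigma' (fun n => (hasSum_fintype _).summable)
    simp only [hfib] at this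
    rw [hg.tsum_eq] at this
    rw [← this]
    exact hs.hasSum
  · intro f hf
    by_cases hm : f.Monic
    · exact absurd ⟨e.symm ⟨f, hm⟩, by simp⟩ hf
    · simp [hm]

open Classical in
lemma aux_sieve (Fq : Type*) [Field Fq] [Fintype Fq]
    {t : ℝ} (ht : 0 < t) (hqt : Fintype.card Fq * t < 1)
    (S : Finset {Q : Fq[X] // Q.Monic ∧ Irreducible Q}) :
    HasSum (fun f : Fq[X] => if f.Monic ∧ ∀ Q ∈ S, ¬ Q.1 ∣ f then t ^ f.natDegree else 0)
      ((∏ Q ∈ S, (1 - t ^ Q.1.natDegree)) * (1 - Fintype.card Fq * t)⁻¹) := by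
  induction S using Finset.induction_on with
  | empty => simpa using aux_hasSum Fq ht hqt
  | insert P S hP ih =>
    have h2 : HasSum (fun f : Fq[X] => if (f.Monic ∧ ∀ Q ∈ S, ¬ Q.1 ∣ f) ∧ P.1 ∣ f
        then t ^ f.natDegree else 0)
        (t ^ P.1.natDegree * ((∏ Q ∈ S, (1 - t ^ Q.1.natDegree)) *
          (1 - Fintype.card Fq * t)⁻¹)) := by
      have hinj : Function.Injective (fun g : Fq[X] => P.1 * g) :=
        mul_right_injective₀ P.2.1.ne_zero
      rw [← hinj.hasSum_iff]
      · convert! ih.mul_left (t ^ P.1.natDegree) using 1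
        funext g
        have hc : ((P.1 * g).Monic ∧ ∀ Q ∈ S, ¬ Q.1 ∣ P.1 * g) ↔
            (g.Monic ∧ ∀ Q ∈ S, ¬ Q.1 ∣ g) := by
          refine and_congr ⟨P.2.1.of_mul_monic_left, P.2.1.mul⟩ (forall₂_congr fun Q hQ => ?_)
          rw [Q.2.2.prime.dvd_mul, or_iff_right]
          intro hd
          have := (Q.2.2.associated_of_dvd P.2.2 hd)
          have := eq_of_monic_of_associated Q.2.1 P.2.1 this
          exact hP (Subtype.ext this ▸ hQ)
        simp only [Function.comp, hc, dvd_mul_right, and_true, mul_ite, mul_zero]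
        split_ifs with h
        · rw [natDegree_mul P.2.1.ne_zero h.1.ne_zero, pow_add]
        · rfl
      · intro f hf
        rw [if_neg]
        rintro ⟨_, g, rfl⟩
        exact hf ⟨g, rfl⟩
    convert! ih.sub h2 using 1
    · funext f
      by_cases h1 : f.Monic ∧ ∀ Q ∈ S, ¬ Q.1 ∣ f
      · by_cases h3 : P.1 ∣ f
        · simp [h1, h3]
        · simp only [Finset.forall_mem_insert, h3, h1, and_false, if_false, sub_zero]
          simp
      · have h4 : ¬ (f.Monic ∧ ∀ Q ∈ insert P S, ¬ Q.1 ∣ f) := fun h =>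
          h1 ⟨h.1, fun Q hQ => h.2 Q (Finset.mem_insert_of_mem hQ)⟩
        rw [if_neg h4, if_neg h1, if_neg (fun h => h1 h.1), sub_zero]
    · rw [Finset.prod_insert hP]; ring

open Classical in
lemma aux_euler (Fq : Type*) [Field Fq] [Fintype Fq]
    {t : ℝ} (ht : 0 < t) (hqt : Fintype.card Fq * t < 1) :
    HasProd (fun Q : {Q : Fq[X] // Q.Monic ∧ Irreducible Q} => 1 - t ^ Q.1.natDegree)
      (1 - Fintype.card Fq * t) := by
  have hlim : Tendsto (fun S : Finset {Q : Fq[X] // Q.Monic ∧ Irreducible Q} =>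
      ∑' f : Fq[X], if f.Monic ∧ ∀ Q ∈ S, ¬ Q.1 ∣ f then t ^ f.natDegree else 0) atTop
      (𝓝 (∑' f : Fq[X], if f = 1 then (1 : ℝ) else 0)) := by
    refine tendsto_tsum_of_dominated_convergence (aux_hasSum Fq ht hqt).summable ?_ ?_
    · intro f
      refine tendsto_const_nhds.congr' ?_
      by_cases h1 : f = 1
      · subst h1
        refine Eventually.of_forall fun S => ?_
        have : ∀ Q ∈ S, ¬ Q.1 ∣ (1 : Fq[X]) := fun Q _ h => Q.2.2.not_isUnit (isUnit_of_dvd_one h)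
        simp only [if_true]
        rw [if_pos ⟨monic_one, this⟩]; simp
      · rw [if_neg h1]
        by_cases hm : f.Monic
        · obtain ⟨g, hg, hi, hd⟩ := exists_monic_irreducible_factor f
            (fun hu => h1 (hm.eq_one_of_isUnit hu))
          filter_upwards [eventually_ge_atTop {⟨g, hg, hi⟩}] with S hS
          rw [if_neg]
          rintro ⟨_, h⟩
          exact h ⟨g, hg, hi⟩ (hS (Finset.mem_singleton_self _)) hd
        · simp [hm]
    · refine Eventually.of_forall fun S f => ?_
      by_cases hm : f.Monic
      · simp only [hm, true_and, if_true]
        split_ifs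
        · rw [Real.norm_of_nonneg (by positivity)]
        · simp; positivity
      · simp [hm]
  simp only [(aux_sieve Fq ht hqt _).tsum_eq, tsum_ite_eq] at hlim
  have hne : (1 - Fintype.card Fq * t) ≠ 0 := by linarith
  have := hlim.mul_const (1 - Fintype.card Fq * t)
  simp only [mul_assoc, inv_mul_cancel₀ hne, mul_one, one_mul] at this
  exact this

lemma aux_summable (Fq : Type*) [Field Fq] [Fintype Fq]
    {t : ℝ} (ht : 0 < t) (hqt : Fintype.card Fq * t < 1) :
    Summable (fun Q : {Q : Fq[X] // Q.Monic ∧ Irreducible Q} => t ^ Q.1.natDegree) := by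
  classical
  have := (aux_hasSum Fq ht hqt).summable.comp_injective
    (Subtype.val_injective (p := fun Q : Fq[X] => Q.Monic ∧ Irreducible Q))
  refine this.congr fun Q => ?_
  simp [Q.2.1]

lemma aux_log {g : ℝ} (hg : |g| ≤ 1 / 2) : |Real.log (1 + g)| ≤ 2 * |g| := by
  obtain ⟨h1, h2⟩ := abs_le.1 hg
  have hp : 0 < 1 + g := by linarith
  have hu := Real.log_le_sub_one_of_pos hp
  have hl := Real.one_sub_inv_le_log_of_pos hp
  have h3 : -(2 * |g|) ≤ 1 - (1 + g)⁻¹ := by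
    have : 1 - (1 + g)⁻¹ = g / (1 + g) := by field_simp; ring
    rw [this, le_div_iff₀ hp]
    rcases abs_cases g with ⟨h, _⟩ | ⟨h, _⟩ <;> rw [h] <;> nlinarith
  rw [abs_le]
  refine ⟨by linarith, ?_⟩
  have := le_abs_self g
  have := abs_nonneg g
  linarith

/-- The local factor minus one. -/
noncomputable def auxG (x s : ℝ) : ℝ := -x ^ (-(2 * s)) - (x - 1) * x ^ (1 - 4 * s)

lemma auxG_bound {x s : ℝ} (hx : 2 ≤ x) (hs : 1 ≤ s) : |auxG x s| ≤ 2 * x ^ (-2 : ℝ) := by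
  have h1 : x ^ (-(2 * s)) ≤ x ^ (-2 : ℝ) :=
    Real.rpow_le_rpow_of_exponent_le (by linarith) (by linarith)
  have h2 : x ^ (1 - 4 * s) ≤ x ^ (-3 : ℝ) :=
    Real.rpow_le_rpow_of_exponent_le (by linarith) (by linarith)
  have h3 : x * x ^ (-3 : ℝ) = x ^ (-2 : ℝ) := by
    rw [← Real.rpow_one_add' (by linarith) (by norm_num)]; norm_num
  have p1 : 0 < x ^ (-(2 * s)) := Real.rpow_pos_of_pos (by linarith) _
  have p2 : 0 < x ^ (1 - 4 * s) := Real.rpow_pos_of_pos (by linarith) _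
  unfold auxG
  have p3 : 0 ≤ (x - 1) * x ^ (1 - 4 * s) := mul_nonneg (by linarith) p2.le
  have p4 : (x - 1) * x ^ (1 - 4 * s) ≤ x * x ^ (-3 : ℝ) := by
    apply mul_le_mul <;> linarith
  rw [abs_le]
  constructor <;> linarith

lemma auxG_half {x s : ℝ} (hx : 2 ≤ x) (hs : 1 ≤ s) : |auxG x s| ≤ 1 / 2 := by
  refine (auxG_bound hx hs).trans ?_
  have : x ^ (-2 : ℝ) ≤ 2 ^ (-2 : ℝ) :=
    Real.rpow_le_rpow_of_nonpos (by norm_num) hx (by norm_num)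
  have h : (2 : ℝ) ^ (-2 : ℝ) = 1 / 4 := by
    rw [Real.rpow_neg (by norm_num)]; norm_num
  rw [h] at this
  linarith

lemma auxG_mul {x s : ℝ} (hx : 2 ≤ x) :
    1 + auxG x s = (1 + (x - 1) * x ^ (-(2 * s))) * (1 - x ^ (1 - 2 * s)) := by
  have h0 : 0 < x := by linarith
  have h1 : x ^ (1 - 2 * s) = x * x ^ (-(2 * s)) := by
    rw [sub_eq_add_neg, Real.rpow_add h0, Real.rpow_one]
  have h2 : x ^ (1 - 4 * s) = x * x ^ (-(2 * s)) * x ^ (-(2 * s)) := by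
    rw [show 1 - 4 * s = 1 + -(2 * s) + -(2 * s) by ring, Real.rpow_add h0, Real.rpow_add h0,
      Real.rpow_one]
  unfold auxG
  rw [h1, h2]; ring

lemma auxG_one {x : ℝ} (hx : 2 ≤ x) :
    1 - 2 * x ^ (-2 : ℝ) + x ^ (-3 : ℝ) = 1 + auxG x 1 := by
  have h3 : x ^ (-2 : ℝ) = x * x ^ (-3 : ℝ) := by
    rw [← Real.rpow_one_add' (by linarith) (by norm_num)]; norm_num
  unfold auxG
  rw [show (-(2 * 1) : ℝ) = -2 by norm_num, show (1 - 4 * 1 : ℝ) = -3 by norm_num, h3]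
  ring

lemma aux_limit {q : ℝ} (hq : 2 ≤ q) :
    Tendsto (fun s : ℝ => (s - 1) / (1 - q ^ (2 - 2 * s))) (𝓝[>] 1) (𝓝 (1 / (2 * Real.log q))) := by
  have h0 : 0 < q := by linarith
  have hd : HasDerivAt (fun s : ℝ => 1 - q ^ (2 - 2 * s)) (2 * Real.log q) 1 := by
    have := (((hasDerivAt_id (1 : ℝ)).const_mul 2).const_sub 2).const_rpow h0
    convert! this.const_sub 1 using 1
    norm_num
    ring
  have h1 := (hasDerivAt_iff_tendsto_slope.1 hd).mono_left
    (nhdsWithin_mono (1 : ℝ) (fun s (hs : 1 < s) => ne_of_gt hs) : 𝓝[>] (1 : ℝ) ≤ _)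
  have hl : 0 < Real.log q := Real.log_pos (by linarith)
  have h2 := h1.inv₀ (by positivity)
  rw [one_div]
  refine h2.congr fun s => ?_
  simp [slope_def_field]

theorem stmt_16 (Fq : Type*) [Field Fq] [Fintype Fq] :
    Multipliable (fun Q : {Q : Fq[X] // Q.Monic ∧ Irreducible Q} =>
      1 - 2 * ((Fintype.card Fq : ℝ) ^ Q.1.natDegree) ^ (-2 : ℝ)
        + ((Fintype.card Fq : ℝ) ^ Q.1.natDegree) ^ (-3 : ℝ)) ∧
    0 < ∏' Q : {Q : Fq[X] // Q.Monic ∧ Irreducible Q},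
      (1 - 2 * ((Fintype.card Fq : ℝ) ^ Q.1.natDegree) ^ (-2 : ℝ)
        + ((Fintype.card Fq : ℝ) ^ Q.1.natDegree) ^ (-3 : ℝ)) ∧
    Tendsto (fun s : ℝ => (s - 1) *
        ∏' Q : {Q : Fq[X] // Q.Monic ∧ Irreducible Q},
          (1 + (((Fintype.card Fq : ℝ) ^ Q.1.natDegree) - 1) *
            ((Fintype.card Fq : ℝ) ^ Q.1.natDegree) ^ (-(2 * s))))
      (𝓝[>] (1 : ℝ))
      (𝓝 ((∏' Q : {Q : Fq[X] // Q.Monic ∧ Irreducible Q},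
          (1 - 2 * ((Fintype.card Fq : ℝ) ^ Q.1.natDegree) ^ (-2 : ℝ)
            + ((Fintype.card Fq : ℝ) ^ Q.1.natDegree) ^ (-3 : ℝ))) /
        (2 * Real.log (Fintype.card Fq)))) := by
  set q : ℝ := (Fintype.card Fq : ℝ) with hqdef
  have hq : 2 ≤ q := by
    have : 1 < Fintype.card Fq := Fintype.one_lt_card
    rw [hqdef]
    exact_mod_cast this
  have h0 : 0 < q := by linarith
  have hN : ∀ Q : {Q : Fq[X] // Q.Monic ∧ Irreducible Q}, 2 ≤ q ^ Q.1.natDegree := fun Q =>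
    hq.trans (le_self_pow₀ (by linarith) Q.2.2.natDegree_pos.ne')
  have hpow : ∀ (n : ℕ) (a : ℝ), (q ^ n) ^ a = (q ^ a) ^ n := fun n a => by
    rw [← Real.rpow_natCast, ← Real.rpow_natCast, ← Real.rpow_mul h0.le, ← Real.rpow_mul h0.le,
      mul_comm]
  have hsum2 : Summable (fun Q : {Q : Fq[X] // Q.Monic ∧ Irreducible Q} =>
      (q ^ Q.1.natDegree) ^ (-2 : ℝ)) := by
    simp only [hpow]
    refine aux_summable Fq (Real.rpow_pos_of_pos h0 _) ?_
    rw [← hqdef, ← Real.rpow_one_add' h0.le (by norm_num)]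
    exact Real.rpow_lt_one_of_one_lt_of_neg (by linarith) (by norm_num)
  have hpos : ∀ s : ℝ, 1 ≤ s → ∀ Q : {Q : Fq[X] // Q.Monic ∧ Irreducible Q},
      0 < 1 + auxG (q ^ Q.1.natDegree) s := fun s hs Q => by
    have := abs_le.1 (auxG_half (hN Q) hs)
    linarith [this.1]
  have hbd : ∀ s : ℝ, 1 ≤ s → ∀ Q : {Q : Fq[X] // Q.Monic ∧ Irreducible Q},
      ‖Real.log (1 + auxG (q ^ Q.1.natDegree) s)‖ ≤ 4 * (q ^ Q.1.natDegree) ^ (-2 : ℝ) :=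
    fun s hs Q => by
      have h1 := aux_log (auxG_half (hN Q) hs)
      have h2 := auxG_bound (hN Q) hs
      rw [Real.norm_eq_abs]
      linarith
  have hlogsum : ∀ s : ℝ, 1 ≤ s → Summable
      (fun Q : {Q : Fq[X] // Q.Monic ∧ Irreducible Q} =>
        Real.log (1 + auxG (q ^ Q.1.natDegree) s)) := fun s hs =>
    Summable.of_norm_bounded (hsum2.mul_left 4) (hbd s hs)
  have hprod : ∀ s : ℝ, 1 ≤ s → HasProd
      (fun Q : {Q : Fq[X] // Q.Monic ∧ Irreducible Q} => 1 + auxG (q ^ Q.1.natDegree) s)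
      (Real.exp (∑' Q : {Q : Fq[X] // Q.Monic ∧ Irreducible Q},
        Real.log (1 + auxG (q ^ Q.1.natDegree) s))) := fun s hs =>
    Real.hasProd_of_hasSum_log (hpos s hs) (hlogsum s hs).hasSum
  have hlim : Tendsto (fun s : ℝ => Real.exp (∑' Q : {Q : Fq[X] // Q.Monic ∧ Irreducible Q},
        Real.log (1 + auxG (q ^ Q.1.natDegree) s))) (𝓝[>] 1)
      (𝓝 (Real.exp (∑' Q : {Q : Fq[X] // Q.Monic ∧ Irreducible Q},
        Real.log (1 + auxG (q ^ Q.1.natDegree) 1)))) := by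
    refine (Real.continuous_exp.tendsto _).comp ?_
    refine tendsto_tsum_of_dominated_convergence (hsum2.mul_left 4) ?_ ?_
    · intro Q
      have hx : 0 < q ^ Q.1.natDegree := by positivity
      have hc : Continuous (fun s : ℝ => 1 + auxG (q ^ Q.1.natDegree) s) := by
        unfold auxG
        have : ∀ h : ℝ → ℝ, Continuous h → Continuous (fun s => (q ^ Q.1.natDegree) ^ h s) :=
          fun h hh => continuous_const.rpow hh (fun _ => Or.inl hx.ne')
        have c1 := this (fun s => -(2 * s)) (by fun_prop)
        have c2 := this (fun s => 1 - 4 * s) (by fun_prop)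
        fun_prop
      exact ((hc.tendsto 1).log (hpos 1 le_rfl Q).ne').mono_left nhdsWithin_le_nhds
    · filter_upwards [self_mem_nhdsWithin] with s hs Q
      exact hbd s (le_of_lt hs) Q
  simp only [fun Q => auxG_one (hN Q)]
  rw [(hprod 1 le_rfl).tprod_eq]
  refine ⟨(hprod 1 le_rfl).multipliable, Real.exp_pos _, ?_⟩
  have hfin := (aux_limit hq).mul hlim
  rw [one_div_mul_eq_div] at hfin
  refine hfin.congr' ?_
  filter_upwards [self_mem_nhdsWithin] with s hs
  have hs' : (1 : ℝ) < s := hs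
  have hqt : q * q ^ (1 - 2 * s) = q ^ (2 - 2 * s) := by
    rw [← Real.rpow_one_add' h0.le (by linarith)]; ring_nf
  have hlt : q ^ (2 - 2 * s) < 1 :=
    Real.rpow_lt_one_of_one_lt_of_neg (by linarith) (by linarith)
  have he := aux_euler Fq (Real.rpow_pos_of_pos h0 (1 - 2 * s)) (by rw [← hqdef, hqt]; exact hlt)
  simp only [← hpow] at he
  rw [← hqdef, hqt] at he
  have hne : 1 - q ^ (2 - 2 * s) ≠ 0 := by linarith
  have hz : Multipliable (fun Q : {Q : Fq[X] // Q.Monic ∧ Irreducible Q} =>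
      1 + ((q ^ Q.1.natDegree) - 1) * (q ^ Q.1.natDegree) ^ (-(2 * s))) := by
    have hS : Summable (fun Q : {Q : Fq[X] // Q.Monic ∧ Irreducible Q} =>
        (q ^ Q.1.natDegree) ^ (1 - 2 * s)) := by
      simp only [hpow]
      exact aux_summable Fq (Real.rpow_pos_of_pos h0 _) (by rw [← hqdef, hqt]; exact hlt)
    refine Real.multipliable_one_add_of_summable (hS.of_nonneg_of_le (fun Q => ?_) fun Q => ?_)
    · have := hN Q
      exact mul_nonneg (by linarith) (by positivity)
    · have hx : 0 < q ^ Q.1.natDegree := by positivity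
      rw [sub_eq_add_neg 1 (2 * s), Real.rpow_add hx, Real.rpow_one]
      exact mul_le_mul_of_nonneg_right (by linarith) (by positivity)
  have hm := hz.hasProd.mul he
  simp only [← fun Q => auxG_mul (s := s) (hN Q)] at hm
  have := hm.unique (hprod s hs'.le)
  rw [← this, div_mul_eq_mul_div, mul_comm _ (1 - q ^ (2 - 2 * s)), mul_left_comm,
    mul_div_cancel_left₀ _ hne]
end
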